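/- arXiv:1912.05739 — 3 statements merged into one kernel-verified Lean document; each statement's English description precedes it below -/
import Mathlib

section
/- Let c ∈ {0,N}. A zero-mean nonsingular Gaussian sequence [x_k], k ∈ [0,N], is CM_c if and only if it can be represented as x_k = y_k + Γ_k x_c for all k ∈ [0,N]\{c}, where [y_k], k ∈ [0,N]\{c}, is a zero-mean nonsingular Gaussian Markov sequence, x_c is a zero-mean nonsingular Gaussian random vector uncorrelated with every y_k, and the Γ_k are d×d matrices. -/
open MeasureTheory ProbabilityTheory Matrix
open scoped NNReal

namespace CMSeqPaper

variable {Ω : Type*} [MeasurableSpace Ω]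

/-- Square `d × d` real matrices. -/
abbrev Mat (d : ℕ) := Matrix (Fin d) (Fin d) ℝ

/-- `X` is a zero-mean jointly Gaussian random vector with covariance matrix `C`
(Cramér–Wold characterization: every linear functional of `X` is a centered real
Gaussian with the induced variance). -/
def IsZeroMeanGaussian {ι : Type*} [Fintype ι] (μ : Measure Ω)
    (X : Ω → ι → ℝ) (C : Matrix ι ι ℝ) : Prop :=
  ∀ l : ι → ℝ,
    μ.map (fun ω => ∑ i, l i * X ω i) = gaussianReal 0 (l ⬝ᵥ C.mulVec l).toNNReal

/-- The stacked vector over times `0, …, N` of a `d`-dimensional sequence. -/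
def stack (N d : ℕ) (x : ℕ → Ω → Fin d → ℝ) : Ω → Fin (N + 1) × Fin d → ℝ :=
  fun ω p => x (p.1 : ℕ) ω p.2

/-- `[x_k]`, `k ∈ [0,N]`, is a zero-mean nonsingular Gaussian sequence whose stacked
vector has (positive definite) covariance matrix `C`. -/
def ZMNG (N d : ℕ) (μ : Measure Ω) (x : ℕ → Ω → Fin d → ℝ)
    (C : Matrix (Fin (N + 1) × Fin d) (Fin (N + 1) × Fin d) ℝ) : Prop :=
  (∀ k, k ≤ N → Measurable (x k)) ∧
    IsZeroMeanGaussian μ (stack N d x) C ∧ C.PosDef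

/-- The σ-algebra generated by the states at the times in `S`. -/
def sigmaOf {d : ℕ} (x : ℕ → Ω → Fin d → ℝ) (S : Set ℕ) : MeasurableSpace Ω :=
  ⨆ i ∈ S, MeasurableSpace.comap (x i) inferInstance

/-- The conditional distribution of `x k` given the states at the times in `S`
coincides (a.e.) with the conditional distribution of `x k` given the states at the
times in `T`. -/
def CondEq {d : ℕ} (μ : Measure Ω) (x : ℕ → Ω → Fin d → ℝ) (k : ℕ)
    (S T : Set ℕ) : Prop :=
  ∀ A : Set (Fin d → ℝ), MeasurableSet A →
    μ[A.indicator (fun _ => (1 : ℝ)) ∘ x k | sigmaOf x S]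
      =ᵐ[μ] μ[A.indicator (fun _ => (1 : ℝ)) ∘ x k | sigmaOf x T]

/-- `[x_k]` is `[k₁,k₂]`-CM_c: for all `k₁ ≤ j < k ≤ k₂`, the conditional
distribution of `x k` given `(x_{k₁}, …, x_j, x_c)` equals the one given `(x_j, x_c)`. -/
def IsCM {d : ℕ} (μ : Measure Ω) (x : ℕ → Ω → Fin d → ℝ) (k₁ k₂ c : ℕ) : Prop :=
  ∀ j k, k₁ ≤ j → j < k → k ≤ k₂ →
    CondEq μ x k (Set.Icc k₁ j ∪ {c}) ({j} ∪ {c})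

/-- `[x_k]` is Markov on the index interval `[a,b]`. -/
def IsMarkovOn {d : ℕ} (μ : Measure Ω) (x : ℕ → Ω → Fin d → ℝ) (a b : ℕ) : Prop :=
  ∀ j k, a ≤ j → j < k → k ≤ b → CondEq μ x k (Set.Icc a j) {j}

/-- `[x_k]` is reciprocal on `[0,N]`. -/
def IsReciprocal {d : ℕ} (μ : Measure Ω) (x : ℕ → Ω → Fin d → ℝ) (N : ℕ) : Prop :=
  ∀ j k l, j < k → k < l → l ≤ N →
    CondEq μ x k (Set.Icc 0 j ∪ Set.Icc l N) ({j} ∪ {l})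

/-- Block `(i,j)` of the block matrix `A` is zero. -/
def BlockZero {n d : ℕ} (A : Matrix (Fin n × Fin d) (Fin n × Fin d) ℝ)
    (i j : Fin n) : Prop :=
  ∀ a b, A (i, a) (j, b) = 0

/-- `|i - j| ≥ 2` for block indices. -/
def Far {n : ℕ} (i j : Fin n) : Prop :=
  (i : ℕ) + 2 ≤ (j : ℕ) ∨ (j : ℕ) + 2 ≤ (i : ℕ)

/-- Block tri-diagonal: every block `(i,j)` with `|i-j| ≥ 2` is zero. -/
def BlockTriDiag {n d : ℕ} (A : Matrix (Fin n × Fin d) (Fin n × Fin d) ℝ) : Prop :=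
  ∀ i j, Far i j → BlockZero A i j

/-- The CM_L form: every block `(i,j)` with `|i-j| ≥ 2` is zero except possibly
blocks in the last block row and last block column. -/
def HasCMLForm {n d : ℕ} (A : Matrix (Fin n × Fin d) (Fin n × Fin d) ℝ) : Prop :=
  ∀ i j, Far i j → (i : ℕ) ≠ n - 1 → (j : ℕ) ≠ n - 1 → BlockZero A i j

/-- The CM_F form: every block `(i,j)` with `|i-j| ≥ 2` is zero except possibly
blocks in the first block row and first block column. -/
def HasCMFForm {n d : ℕ} (A : Matrix (Fin n × Fin d) (Fin n × Fin d) ℝ) : Prop :=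
  ∀ i j, Far i j → (i : ℕ) ≠ 0 → (j : ℕ) ≠ 0 → BlockZero A i j

/-- Cyclic block tri-diagonal: every block `(i,j)` with `|i-j| ≥ 2` is zero except
possibly the corner blocks `(0, n-1)` and `(n-1, 0)`. -/
def CyclicBlockTriDiag {n d : ℕ} (A : Matrix (Fin n × Fin d) (Fin n × Fin d) ℝ) : Prop :=
  ∀ i j, Far i j → ¬((i : ℕ) = 0 ∧ (j : ℕ) = n - 1) →
    ¬((i : ℕ) = n - 1 ∧ (j : ℕ) = 0) → BlockZero A i j

/-- The stacked block-diagonal matrix with diagonal blocks `G 0, …, G N`. -/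
def blockDiag (N d : ℕ) (G : ℕ → Mat d) :
    Matrix (Fin (N + 1) × Fin d) (Fin (N + 1) × Fin d) ℝ :=
  fun p q => if (p.1 : ℕ) = (q.1 : ℕ) then G (p.1 : ℕ) p.2 q.2 else 0

/-- `[x_k]` obeys the CM_L model with parameters `Gm k = G_{k,k-1}` and
`GN k = G_{k,N}` for `k ∈ [1,N-1]`, boundary parameter `GN 0 = G_{0,N}`, and noise
covariances `Gcov k = G_k = Cov(e_k)`: the `e_k` are zero-mean jointly Gaussian,
mutually uncorrelated, with positive definite covariances, with
`x_k = G_{k,k-1} x_{k-1} + G_{k,N} x_N + e_k` for `k ∈ [1,N-1]`, and boundary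
condition `x_N = e_N`, `x_0 = G_{0,N} x_N + e_0`. -/
def CMLModel (N d : ℕ) (μ : Measure Ω) (x : ℕ → Ω → Fin d → ℝ)
    (Gm GN Gcov : ℕ → Mat d) : Prop :=
  ∃ e : ℕ → Ω → Fin d → ℝ,
    ZMNG N d μ e (blockDiag N d Gcov) ∧
    (∀ k, k ≤ N → (Gcov k).PosDef) ∧
    (∀ᵐ ω ∂μ,
      (∀ k, 1 ≤ k → k ≤ N - 1 →
        x k ω = (Gm k).mulVec (x (k - 1) ω) + (GN k).mulVec (x N ω) + e k ω) ∧
      x N ω = e N ω ∧ x 0 ω = (GN 0).mulVec (x N ω) + e 0 ω)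

/-- `[y_k]` obeys the Markov model with parameters `Mm k = M_{k,k-1}` for
`k ∈ [1,N]` and noise covariances `Mcov k = M_k = Cov(e_k)`: the `e_k` are
zero-mean jointly Gaussian, mutually uncorrelated, with positive definite
covariances, `y_0 = e_0` and `y_k = M_{k,k-1} y_{k-1} + e_k` for `k ∈ [1,N]`. -/
def MarkovModel (N d : ℕ) (μ : Measure Ω) (y : ℕ → Ω → Fin d → ℝ)
    (Mm Mcov : ℕ → Mat d) : Prop :=
  ∃ e : ℕ → Ω → Fin d → ℝ,
    ZMNG N d μ e (blockDiag N d Mcov) ∧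
    (∀ k, k ≤ N → (Mcov k).PosDef) ∧
    (∀ᵐ ω ∂μ, y 0 ω = e 0 ω ∧
      ∀ k, 1 ≤ k → k ≤ N → y k ω = (Mm k).mulVec (y (k - 1) ω) + e k ω)

/-- Representation of `[x_k]` as a zero-mean nonsingular Gaussian Markov sequence
plus `Γ_k x_c`, where `c ∈ {0,N}`: `y` (which coincides with `x` at time `c`) is
jointly zero-mean nonsingular Gaussian, the states of `y` at times `≠ c` are
uncorrelated with `y c = x c`, `y` is Markov on `[0,N] \ {c}`, and
`x_k = y_k + Γ_k x_c` for `k ∈ [0,N] \ {c}`. -/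
def MarkovPlusVector (N d c : ℕ) (μ : Measure Ω) (x y : ℕ → Ω → Fin d → ℝ)
    (Γ : ℕ → Mat d) : Prop :=
  ∃ C' : Matrix (Fin (N + 1) × Fin d) (Fin (N + 1) × Fin d) ℝ,
    (∀ᵐ ω ∂μ, y c ω = x c ω) ∧
    ZMNG N d μ y C' ∧
    (∀ i j : Fin (N + 1),
      (((i : ℕ) = c ∧ (j : ℕ) ≠ c) ∨ ((i : ℕ) ≠ c ∧ (j : ℕ) = c)) →
      ∀ a b, C' (i, a) (j, b) = 0) ∧
    IsMarkovOn μ y (if c = 0 then 1 else 0) (if c = 0 then N else N - 1) ∧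
    (∀ᵐ ω ∂μ, ∀ k, k ≤ N → k ≠ c → x k ω = y k ω + (Γ k).mulVec (x c ω))

/-- `M_{N|k} = M_{N,N-1} ⋯ M_{k+1,k}` (with `M_{N|N} = I`), where `Mm k = M_{k,k-1}`. -/
def MNk (d : ℕ) (Mm : ℕ → Mat d) (N k : ℕ) : Mat d :=
  (List.range (N - k)).foldl (fun A i => A * Mm (N - i)) 1

/-- `C_{N|k} = ∑_{n=k}^{N-1} M_{N|n+1} M_{n+1} M_{N|n+1}'`. -/
def CNk (d : ℕ) (Mm Mcov : ℕ → Mat d) (N k : ℕ) : Mat d :=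
  ∑ n ∈ Finset.Icc k (N - 1), MNk d Mm N (n + 1) * Mcov (n + 1) * (MNk d Mm N (n + 1))ᵀ

/-- The `(N+1)d × (N+1)d` matrix `[[B₁, 0], [0, 0]]` (`B₁` occupies the first `N`
block rows and columns). -/
def embedL (N d : ℕ) (B₁ : Matrix (Fin N × Fin d) (Fin N × Fin d) ℝ) :
    Matrix (Fin (N + 1) × Fin d) (Fin (N + 1) × Fin d) ℝ :=
  fun p q =>
    if h : (p.1 : ℕ) < N ∧ (q.1 : ℕ) < N then
      B₁ (⟨(p.1 : ℕ), h.1⟩, p.2) (⟨(q.1 : ℕ), h.2⟩, q.2)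
    else 0

/-- The `(N+1)d × d` matrix `Γ = [S; I]`. -/
def gammaL (N d : ℕ) (S : Matrix (Fin N × Fin d) (Fin d) ℝ) :
    Matrix (Fin (N + 1) × Fin d) (Fin d) ℝ :=
  fun p a =>
    if h : (p.1 : ℕ) < N then S (⟨(p.1 : ℕ), h⟩, p.2) a
    else (1 : Mat d) p.2 a

/-- The `(N+1)d × (N+1)d` matrix `[[0, 0], [0, B₂]]` (`B₂` occupies the last `N`
block rows and columns). -/
def embedF (N d : ℕ) (B₂ : Matrix (Fin N × Fin d) (Fin N × Fin d) ℝ) :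
    Matrix (Fin (N + 1) × Fin d) (Fin (N + 1) × Fin d) ℝ :=
  fun p q =>
    if h : 0 < (p.1 : ℕ) ∧ 0 < (q.1 : ℕ) then
      B₂ (⟨(p.1 : ℕ) - 1, by have := p.1.isLt; omega⟩, p.2)
        (⟨(q.1 : ℕ) - 1, by have := q.1.isLt; omega⟩, q.2)
    else 0

/-- The `(N+1)d × d` matrix `Γ = [I; S]`. -/
def gammaF (N d : ℕ) (S : Matrix (Fin N × Fin d) (Fin d) ℝ) :
    Matrix (Fin (N + 1) × Fin d) (Fin d) ℝ :=
  fun p a =>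
    if h : 0 < (p.1 : ℕ) then
      S (⟨(p.1 : ℕ) - 1, by have := p.1.isLt; omega⟩, p.2) a
    else (1 : Mat d) p.2 a
section AuxProb

/-- conditional expectation only depends on the a.e. class of the conditioning variable -/
lemma condExp_comap_congr {E : Type*} [MeasurableSpace E] {μ : Measure Ω} [IsProbabilityMeasure μ]
    {X X' : Ω → E} (hX : Measurable X) (hX' : Measurable X') (h : X =ᵐ[μ] X')
    {f : Ω → ℝ} (hf : Integrable f μ) :
    μ[f | MeasurableSpace.comap X inferInstance] =ᵐ[μ]
      μ[f | MeasurableSpace.comap X' inferInstance] := by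
  refine ae_eq_condExp_of_forall_setIntegral_eq hX'.comap_le hf
    (fun s _ _ => integrable_condExp.integrableOn) ?_ ?_
  · rintro s ⟨t, ht, rfl⟩ -
    have hst : (X' ⁻¹' t : Set Ω) =ᵐ[μ] (X ⁻¹' t : Set Ω) := by
      filter_upwards [h] with ω hω
      apply propext
      change X' ω ∈ t ↔ X ω ∈ t
      rw [hω]
    rw [setIntegral_congr_set hst, setIntegral_congr_set hst]
    exact setIntegral_condExp hX.comap_le hf ⟨t, ht, rfl⟩
  · have h1 : StronglyMeasurable[MeasurableSpace.comap X inferInstance]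
      (μ[f | MeasurableSpace.comap X inferInstance]) := stronglyMeasurable_condExp
    obtain ⟨g, hg, hgX⟩ := h1.exists_eq_measurable_comp
    rw [hgX]
    refine ⟨g ∘ X', hg.comp_measurable (comap_measurable X'), ?_⟩
    filter_upwards [h] with ω hω
    simp [hω]

lemma integrable_ind {Ω : Type*} {m0 : MeasurableSpace Ω} {μ : Measure Ω} [IsProbabilityMeasure μ]
    {G : Type*} [MeasurableSpace G] {v : Ω → G} (hv : Measurable v) {A : Set G}
    (hA : MeasurableSet A) : Integrable (A.indicator (fun _ => (1 : ℝ)) ∘ v) μ := by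
  have : A.indicator (fun _ => (1 : ℝ)) ∘ v = (v ⁻¹' A).indicator (fun _ => (1 : ℝ)) := rfl
  rw [this]
  exact (integrable_const _).indicator (hv hA)

lemma setIntegral_of_indep {Ω : Type*} {m₁ m₃ m0 : MeasurableSpace Ω} {μ : Measure Ω} [IsProbabilityMeasure μ]
    (h₁ : m₁ ≤ m0) (h₃ : m₃ ≤ m0)
    (hind : Indep m₁ m₃ μ) {f : Ω → ℝ} (hf : StronglyMeasurable[m₁] f) (hfi : Integrable f μ)
    {a b : Set Ω} (ha : MeasurableSet[m₁] a) (hb : MeasurableSet[m₃] b) :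
    ∫ ω in a ∩ b, f ω ∂μ = μ.real b * ∫ ω in a, f ω ∂μ := by
  have h := condExp_indep_eq h₁ h₃ (hf.indicator ha) hind
  have h2 := setIntegral_condExp h₃ (hfi.indicator (h₁ _ ha)) hb
  rw [Set.inter_comm, ← setIntegral_indicator (h₁ _ ha), ← h2,
    setIntegral_congr_ae (h₃ _ hb) (h.mono fun ω hω _ => hω)]
  simp [integral_indicator (h₁ _ ha)]

lemma condExp_sup_of_indep {Ω : Type*} {m₁ m₂ m₃ m0 : MeasurableSpace Ω} {μ : Measure Ω} [IsProbabilityMeasure μ]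
    (h₁ : m₁ ≤ m0) (h₃ : m₃ ≤ m0) (h₂₁ : m₂ ≤ m₁)
    (hind : Indep m₁ m₃ μ) {f : Ω → ℝ} (hf : StronglyMeasurable[m₁] f) (hfi : Integrable f μ) :
    μ[f | m₂] =ᵐ[μ] μ[f | m₂ ⊔ m₃] := by
  have h₂ : m₂ ≤ m0 := h₂₁.trans h₁
  have hs : m₂ ⊔ m₃ ≤ m0 := sup_le h₂ h₃
  have hgm : StronglyMeasurable[m₂ ⊔ m₃] (μ[f | m₂]) :=
    stronglyMeasurable_condExp.mono (le_sup_left : m₂ ≤ m₂ ⊔ m₃)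
  refine ae_eq_condExp_of_forall_setIntegral_eq hs hfi
    (fun s _ _ => integrable_condExp.integrableOn) ?_ hgm.aestronglyMeasurable
  intro s hsm _
  let P : Set (Set Ω) := {u | ∃ a b, MeasurableSet[m₂] a ∧ MeasurableSet[m₃] b ∧ a ∩ b = u}
  have hgen : m₂ ⊔ m₃ = MeasurableSpace.generateFrom P := by
    apply le_antisymm
    · refine sup_le (fun a ha => ?_) (fun b hb => ?_)
      · exact MeasurableSpace.measurableSet_generateFrom ⟨a, Set.univ, ha, MeasurableSet.univ, by simp⟩
      · exact MeasurableSpace.measurableSet_generateFrom ⟨Set.univ, b, MeasurableSet.univ, hb, by simp⟩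
    · refine MeasurableSpace.generateFrom_le ?_
      rintro _ ⟨a, b, ha, hb, rfl⟩
      exact MeasurableSet.inter ((le_sup_left : m₂ ≤ m₂ ⊔ m₃) _ ha)
        ((le_sup_right : m₃ ≤ m₂ ⊔ m₃) _ hb)
  have hpi : IsPiSystem P := by
    rintro _ ⟨a, b, ha, hb, rfl⟩ _ ⟨a', b', ha', hb', rfl⟩ -
    exact ⟨a ∩ a', b ∩ b', ha.inter ha', hb.inter hb', by ac_rfl⟩
  have hgi : Integrable (μ[f | m₂]) μ := integrable_condExp
  induction s, hsm using MeasurableSpace.induction_on_inter hgen hpi with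
  | empty => simp
  | basic t ht =>
    obtain ⟨a, b, ha, hb, rfl⟩ := ht
    rw [setIntegral_of_indep h₁ h₃ hind (stronglyMeasurable_condExp.mono h₂₁) hgi (h₂₁ _ ha) hb,
      setIntegral_of_indep h₁ h₃ hind hf hfi (h₂₁ _ ha) hb, setIntegral_condExp h₂ hfi ha]
  | compl t ht ih =>
    have e1 := integral_add_compl (hs _ ht) hgi
    have e2 := integral_add_compl (hs _ ht) hfi
    have e3 := integral_condExp h₂ (f := f) (μ := μ)
    have e4 := ih (measure_lt_top _ _)
    linarith
  | iUnion g hd hm ih =>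
    rw [integral_iUnion (fun i => hs _ (hm i)) hd hgi.integrableOn,
      integral_iUnion (fun i => hs _ (hm i)) hd hfi.integrableOn]
    exact tsum_congr fun i => ih i (measure_lt_top _ _)

lemma condExp_pair {Ω : Type*} {m₁ m₂ m0 : MeasurableSpace Ω} {μ : Measure Ω} [IsProbabilityMeasure μ]
    (h₁ : m₁ ≤ m0) (h₂ : m₂ ≤ m0)
    {E F : Type*} [MeasurableSpace E] [MeasurableSpace F] {u : Ω → E} {w : Ω → F}
    (hu : Measurable u) (hw₁ : Measurable[m₁] w) (hw₂ : Measurable[m₂] w)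
    (h : ∀ A : Set E, MeasurableSet A →
      μ[A.indicator (fun _ => (1 : ℝ)) ∘ u | m₁] =ᵐ[μ] μ[A.indicator (fun _ => (1 : ℝ)) ∘ u | m₂])
    {B : Set (E × F)} (hB : MeasurableSet B) :
    μ[B.indicator (fun _ => (1 : ℝ)) ∘ (fun ω => (u ω, w ω)) | m₁] =ᵐ[μ]
      μ[B.indicator (fun _ => (1 : ℝ)) ∘ (fun ω => (u ω, w ω)) | m₂] := by
  have hw : Measurable w := hw₁.mono h₁ le_rfl
  have hp : Measurable (fun ω => (u ω, w ω)) := hu.prodMk hw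
  induction B, hB using MeasurableSpace.induction_on_inter generateFrom_prod.symm isPiSystem_prod with
  | empty => simp [Function.comp_def]
  | basic t ht =>
    obtain ⟨A, hA, D, hD, rfl⟩ := ht
    have hA : MeasurableSet A := hA
    have hD : MeasurableSet D := hD
    have e : (A ×ˢ D).indicator (fun _ => (1 : ℝ)) ∘ (fun ω => (u ω, w ω)) =
        (D.indicator (fun _ => (1 : ℝ)) ∘ w) * (A.indicator (fun _ => (1 : ℝ)) ∘ u) := by
      ext ω
      simp only [Function.comp, Pi.mul_apply, Set.indicator, Set.mem_prod]
      by_cases h1 : u ω ∈ A <;> by_cases h2 : w ω ∈ D <;> simp [h1, h2]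
    have hi := integrable_ind (μ := μ) hp (hA.prod hD)
    rw [e] at hi ⊢
    have key : ∀ m : MeasurableSpace Ω, Measurable[m] w →
        StronglyMeasurable[m] (D.indicator (fun _ => (1 : ℝ)) ∘ w) := fun m hm =>
      ((measurable_const.indicator hD).comp hm).stronglyMeasurable
    have a1 := condExp_mul_of_stronglyMeasurable_left (key m₁ hw₁) hi (integrable_ind hu hA)
    have a2 := condExp_mul_of_stronglyMeasurable_left (key m₂ hw₂) hi (integrable_ind hu hA)
    filter_upwards [a1, a2, h A hA] with ω b1 b2 b3
    rw [b1, b2, Pi.mul_apply, Pi.mul_apply, b3]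
  | compl t ht ih =>
    have e : (tᶜ).indicator (fun _ => (1 : ℝ)) ∘ (fun ω => (u ω, w ω)) =
        (fun _ => (1 : ℝ)) - t.indicator (fun _ => (1 : ℝ)) ∘ (fun ω => (u ω, w ω)) := by
      ext ω
      by_cases h1 : (u ω, w ω) ∈ t <;> simp [Set.indicator, h1]
    rw [e]
    have a1 := condExp_sub (integrable_const (μ := μ) (1 : ℝ)) (integrable_ind hp ht) m₁
    have a2 := condExp_sub (integrable_const (μ := μ) (1 : ℝ)) (integrable_ind hp ht) m₂
    filter_upwards [a1, a2, ih] with ω b1 b2 b3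
    rw [b1, b2, Pi.sub_apply, Pi.sub_apply, b3, condExp_const h₁, condExp_const h₂]
  | iUnion g hd hm ih =>
    have e : (⋃ i, g i).indicator (fun _ => (1 : ℝ)) ∘ (fun ω => (u ω, w ω)) =
        fun ω => ∑' i, ((g i).indicator (fun _ => (1 : ℝ)) ∘ (fun ω => (u ω, w ω))) ω := by
      ext ω
      simp only [Function.comp]
      by_cases h1 : ∃ i, (u ω, w ω) ∈ g i
      · obtain ⟨i, hi⟩ := h1
        rw [tsum_eq_single i]
        · rw [Set.indicator_of_mem hi, Set.indicator_of_mem (Set.mem_iUnion.2 ⟨i, hi⟩)]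
        · intro j hj
          exact Set.indicator_of_notMem (fun hj' => Set.disjoint_left.1 (hd hj) hj' hi) _
      · have h2 : ∀ i, (u ω, w ω) ∉ g i := fun i hi => h1 ⟨i, hi⟩
        simp [Set.indicator, h2]
    have hfin : ∑' i, ∫⁻ a, ‖((g i).indicator (fun _ => (1 : ℝ)) ∘ (fun ω => (u ω, w ω))) a‖ₑ ∂μ
        ≠ ⊤ := by
      have : ∀ i, ∫⁻ a, ‖((g i).indicator (fun _ => (1 : ℝ)) ∘ (fun ω => (u ω, w ω))) a‖ₑ ∂μ
        = μ ((fun ω => (u ω, w ω)) ⁻¹' (g i)) := by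
        intro i
        rw [← lintegral_indicator_one (hp (hm i))]
        refine lintegral_congr fun a => ?_
        by_cases h1 : (u a, w a) ∈ g i <;> simp [Set.indicator, h1]
      simp_rw [this]
      rw [← measure_iUnion (fun i j hij => (hd hij).preimage _) (fun i => hp (hm i))]
      exact measure_ne_top _ _
    rw [e]
    have a1 := condExp_tsum (m := m₁) (fun i => (integrable_ind hp (hm i)).1) hfin
    have a2 := condExp_tsum (m := m₂) (fun i => (integrable_ind hp (hm i)).1) hfin
    filter_upwards [a1, a2, ae_all_iff.2 ih] with ω b1 b2 b3
    rw [b1, b2]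
    exact tsum_congr b3

end AuxProb

section AuxGauss

lemma charFunDual_of_gaussian {ι : Type*} [Fintype ι] {μ : Measure Ω}
    {X : Ω → ι → ℝ} {C : Matrix ι ι ℝ} (hG : IsZeroMeanGaussian μ X C) (hC : C.PosSemidef)
    {F : Type*} [NormedAddCommGroup F] [NormedSpace ℝ F] [MeasurableSpace F] [BorelSpace F]
    {Z : Ω → F} (hZ : Measurable Z) (L : StrongDual ℝ F) (l : ι → ℝ)
    (hL : ∀ ω, L (Z ω) = ∑ i, l i * X ω i) :
    charFunDual (μ.map Z) L = Complex.exp (((-(l ⬝ᵥ C.mulVec l) / 2 : ℝ) : ℂ)) := by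
  have h0 : 0 ≤ l ⬝ᵥ C.mulVec l := by simpa using hC.dotProduct_mulVec_nonneg l
  rw [charFunDual_eq_charFun_map_one, Measure.map_map L.continuous.measurable hZ]
  have : (L ∘ Z) = fun ω => ∑ i, l i * X ω i := funext hL
  rw [this, hG l, charFun_gaussianReal]
  congr 1
  simp [Real.coe_toNNReal _ h0]
  ring

lemma indepFun_of_gaussian {ι : Type*} [Fintype ι] {μ : Measure Ω} [IsProbabilityMeasure μ]
    {X : Ω → ι → ℝ} (hX : Measurable X) {C : Matrix ι ι ℝ} (hG : IsZeroMeanGaussian μ X C)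
    (hC : C.PosSemidef) (p : ι → Prop)
    (h : ∀ i j, p i → ¬ p j → C i j = 0) (h' : ∀ i j, ¬ p i → p j → C i j = 0) :
    IndepFun (fun ω (i : {i // p i}) => X ω i) (fun ω (i : {i // ¬ p i}) => X ω i) μ := by
  classical
  have hm1 : Measurable (fun ω (i : {i // p i}) => X ω i) :=
    measurable_pi_lambda _ fun i => (measurable_pi_apply _).comp hX
  have hm2 : Measurable (fun ω (i : {i // ¬ p i}) => X ω i) :=
    measurable_pi_lambda _ fun i => (measurable_pi_apply _).comp hX
  rw [indepFun_iff_charFunDual_prod hm1.aemeasurable hm2.aemeasurable]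
  intro L
  let L1 := L.comp (.inl ℝ ({i // p i} → ℝ) ({i // ¬ p i} → ℝ))
  let L2 := L.comp (.inr ℝ ({i // p i} → ℝ) ({i // ¬ p i} → ℝ))
  let l1 : ι → ℝ := fun i => if hi : p i then L1 (Pi.single ⟨i, hi⟩ 1) else 0
  let l2 : ι → ℝ := fun i => if hi : p i then 0 else L2 (Pi.single ⟨i, hi⟩ 1)
  have hL1 : ∀ ω, L1 (fun i => X ω i) = ∑ i, l1 i * X ω i := by
    intro ω
    rw [← Fintype.sum_subtype_add_sum_subtype p]
    have e2 : ∑ i : {i // ¬ p i}, l1 i * X ω i = 0 :=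
      Finset.sum_eq_zero fun i _ => by simp [l1, i.2]
    rw [e2, add_zero, pi_eq_sum_univ' (fun i : {i // p i} => X ω i), map_sum]
    refine Finset.sum_congr rfl fun i _ => ?_
    rw [map_smul, smul_eq_mul, mul_comm]
    congr 1
    simp only [l1, i.2, dif_pos]
  have hL2 : ∀ ω, L2 (fun i => X ω i) = ∑ i, l2 i * X ω i := by
    intro ω
    rw [← Fintype.sum_subtype_add_sum_subtype p]
    have e2 : ∑ i : {i // p i}, l2 i * X ω i = 0 :=
      Finset.sum_eq_zero fun i _ => by simp [l2, i.2]
    rw [e2, zero_add, pi_eq_sum_univ' (fun i : {i // ¬ p i} => X ω i), map_sum]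
    refine Finset.sum_congr rfl fun i _ => ?_
    rw [map_smul, smul_eq_mul, mul_comm]
    congr 1
    simp only [l2, i.2, dif_neg, not_false_eq_true]
  have hL : ∀ ω, L (fun i => X ω i, fun i => X ω i) = ∑ i, (l1 + l2) i * X ω i := by
    intro ω
    simp only [Pi.add_apply, add_mul, Finset.sum_add_distrib]
    rw [← hL1, ← hL2]
    simp only [L1, L2, ContinuousLinearMap.comp_apply, ← map_add]
    simp
  rw [charFunDual_of_gaussian hG hC (hm1.prodMk hm2) L (l1 + l2) hL,
    charFunDual_of_gaussian hG hC hm1 L1 l1 hL1,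
    charFunDual_of_gaussian hG hC hm2 L2 l2 hL2, ← Complex.exp_add]
  have z1 : l1 ⬝ᵥ C.mulVec l2 = 0 := by
    simp only [dotProduct, mulVec, Finset.mul_sum]
    refine Finset.sum_eq_zero fun i _ => Finset.sum_eq_zero fun j _ => ?_
    by_cases hi : p i <;> by_cases hj : p j <;> simp [l1, l2, hi, hj, h]
  have z2 : l2 ⬝ᵥ C.mulVec l1 = 0 := by
    simp only [dotProduct, mulVec, Finset.mul_sum]
    refine Finset.sum_eq_zero fun i _ => Finset.sum_eq_zero fun j _ => ?_
    by_cases hi : p i <;> by_cases hj : p j <;> simp [l1, l2, hi, hj, h']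
  rw [mulVec_add, add_dotProduct, dotProduct_add, dotProduct_add, z1, z2]
  congr 1
  push_cast
  ring

lemma IsZeroMeanGaussian.linear {ι : Type*} [Fintype ι] {μ : Measure Ω}
    {X : Ω → ι → ℝ} {C : Matrix ι ι ℝ} (hG : IsZeroMeanGaussian μ X C) (T : Matrix ι ι ℝ) :
    IsZeroMeanGaussian μ (fun ω => T.mulVec (X ω)) (T * C * Tᵀ) := by
  intro l
  have h := hG (Tᵀ.mulVec l)
  have e : (fun ω => ∑ i, l i * (T.mulVec (X ω)) i) =
      fun ω => ∑ i, (Tᵀ.mulVec l) i * X ω i := by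
    ext ω
    change l ⬝ᵥ T.mulVec (X ω) = Tᵀ.mulVec l ⬝ᵥ X ω
    rw [dotProduct_mulVec, mulVec_transpose]
  rw [e, h]
  congr 2
  rw [← mulVec_mulVec, ← mulVec_mulVec, dotProduct_mulVec l, mulVec_transpose]

lemma exists_decor {N d c : ℕ} (hcN : c ≤ N) {μ : Measure Ω} {x : ℕ → Ω → Fin d → ℝ}
    {C : Matrix (Fin (N + 1) × Fin d) (Fin (N + 1) × Fin d) ℝ} (hx : ZMNG N d μ x C) :
    ∃ (Γ : ℕ → Mat d) (C' : Matrix (Fin (N + 1) × Fin d) (Fin (N + 1) × Fin d) ℝ),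
      ZMNG N d μ (fun k ω => if k = c then x c ω else x k ω - (Γ k).mulVec (x c ω)) C' ∧
      (∀ i j : Fin (N + 1),
        (((i : ℕ) = c ∧ (j : ℕ) ≠ c) ∨ ((i : ℕ) ≠ c ∧ (j : ℕ) = c)) →
        ∀ a b, C' (i, a) (j, b) = 0) := by
  obtain ⟨hxm, hxG, hxP⟩ := hx
  let c0 : Fin (N + 1) := ⟨c, by omega⟩
  let D : Mat d := C.submatrix (fun a => (c0, a)) (fun a => (c0, a))
  have hD : D.PosDef := hxP.submatrix (fun a b hab => by simpa using hab)
  let R : Fin (N + 1) → Mat d := fun k => C.submatrix (fun a => (k, a)) (fun a => (c0, a))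
  let Γ : ℕ → Mat d := fun k => if hk : k < N + 1 then R ⟨k, hk⟩ * D⁻¹ else 0
  have hΓ : ∀ k : Fin (N + 1), Γ k * D = R k := by
    intro k
    simp only [Γ, k.2, dif_pos]
    rw [Matrix.mul_assoc, nonsing_inv_mul D ((isUnit_iff_isUnit_det D).1 hD.isUnit), Matrix.mul_one]
  let G : Matrix (Fin (N + 1) × Fin d) (Fin (N + 1) × Fin d) ℝ := fun p q =>
    if q.1 = c0 ∧ p.1 ≠ c0 then Γ p.1 p.2 q.2 else 0
  have hGG : G * G = 0 := by
    ext p q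
    rw [mul_apply, Matrix.zero_apply]
    refine Finset.sum_eq_zero fun r _ => ?_
    by_cases hr : r.1 = c0 <;> simp [G, hr]
  have hT : (1 - G) * (1 + G) = 1 := by
    rw [sub_mul, mul_add, mul_add, hGG]; simp
  have hinj : Function.Injective (1 - G).vecMul := by
    intro u v huv
    have := congrArg (fun w => w ᵥ* (1 + G)) huv
    simpa [vecMul_vecMul, hT] using this
  have hGsum : ∀ (f : Fin (N + 1) × Fin d → ℝ) (p : Fin (N + 1) × Fin d), p.1 ≠ c0 →
      ∑ q, G p q * f q = ∑ e, Γ p.1 p.2 e * f (c0, e) := by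
    intro f p hp
    rw [Fintype.sum_prod_type, Finset.sum_eq_single c0]
    · simp [G, hp]
    · intro b _ hb
      simp [G, hb]
    · simp
  have hG0 : ∀ (p q : Fin (N + 1) × Fin d), p.1 = c0 → G p q = 0 := by
    intro p q hp; simp [G, hp]
  have hsym : ∀ p q, C p q = C q p := fun p q => by
    simpa using (hxP.1.apply p q).symm
  have key : ∀ (j : Fin (N + 1)) (a b), j ≠ c0 →
      ((1 - G) * C * (1 - G)ᵀ : Matrix (Fin (N + 1) × Fin d) (Fin (N + 1) × Fin d) ℝ) (c0, a) (j, b) = 0 := by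
    intro j a b hj
    have h1 : ∀ q, ((1 - G) * C) (c0, a) q = C (c0, a) q := by
      intro q
      rw [sub_mul, Matrix.sub_apply, Matrix.one_mul, mul_apply]
      simp [hG0]
    rw [mul_apply]
    simp only [h1, transpose_apply, Matrix.sub_apply, mul_sub, Finset.sum_sub_distrib]
    have h2 : ∑ q, C (c0, a) q * (1 : Matrix (Fin (N + 1) × Fin d) (Fin (N + 1) × Fin d) ℝ) (j, b) q
        = C (c0, a) (j, b) := by
      simp [one_apply]
    have h3 : ∑ q, C (c0, a) q * G (j, b) q = C (j, b) (c0, a) := by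
      have := hGsum (fun q => C (c0, a) q) (j, b) hj
      simp only [mul_comm (C (c0, a) _)]
      rw [this]
      have h4 := congrFun (congrFun (hΓ j) b) a
      rw [mul_apply] at h4
      simp only [D, R, submatrix_apply] at h4
      rw [← h4]
      exact Finset.sum_congr rfl fun e _ => by rw [hsym]
    rw [h2, h3, hsym, sub_self]
  have hP : ((1 - G) * C * (1 - G)ᵀ).PosDef := by
    have := hxP.mul_mul_conjTranspose_same hinj
    rwa [conjTranspose_eq_transpose_of_trivial] at this
  refine ⟨Γ, (1 - G) * C * (1 - G)ᵀ, ⟨?_, ?_, hP⟩, ?_⟩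
  · intro k hk
    by_cases hkc : k = c
    · simpa [hkc] using hxm c hcN
    · simp only [hkc, if_false]
      refine (hxm k hk).sub ?_
      have : Continuous (fun v : Fin d → ℝ => (Γ k).mulVec v) := by fun_prop
      exact this.measurable.comp (hxm c hcN)
  · have := hxG.linear (1 - G)
    convert this using 1
    ext ω p
    rw [sub_mulVec, one_mulVec, Pi.sub_apply]
    by_cases hp : p.1 = c0
    · have e : (G *ᵥ stack N d x ω) p = 0 := by
        simp [mulVec, dotProduct, hG0 p _ hp]
      rw [e]
      have : (p.1 : ℕ) = c := by rw [hp]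
      simp [stack, this]
    · have e : (G *ᵥ stack N d x ω) p = ((Γ p.1).mulVec (x c ω)) p.2 := by
        simp only [mulVec, dotProduct]
        rw [hGsum _ p hp]
        rfl
      rw [e]
      have : (p.1 : ℕ) ≠ c := fun h => hp (Fin.ext h)
      simp [stack, this]
  · rintro i j (⟨hi, hj⟩ | ⟨hi, hj⟩) a b
    · have hi : i = c0 := Fin.ext hi
      subst hi
      exact key j a b fun h => hj (by rw [h])
    · have hj : j = c0 := Fin.ext hj
      subst hj
      have := hP.1.apply (i, a) (c0, b)
      rw [← this]
      simpa using key i b a fun h => hi (by rw [h])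

end AuxGauss

section AuxSeq

lemma sigmaOf_le_of {Ω : Type*} {m : MeasurableSpace Ω} {d : ℕ} {x : ℕ → Ω → Fin d → ℝ}
    {S : Set ℕ} (h : ∀ i ∈ S, Measurable[m] (x i)) : sigmaOf x S ≤ m :=
  iSup₂_le fun i hi => (h i hi).comap_le

lemma measurable_sigmaOf {Ω : Type*} {d : ℕ} {x : ℕ → Ω → Fin d → ℝ}
    {S : Set ℕ} {i : ℕ} (hi : i ∈ S) : Measurable[sigmaOf x S] (x i) :=
  measurable_iff_comap_le.2
    (le_iSup₂ (f := fun i (_ : i ∈ S) => MeasurableSpace.comap (x i) inferInstance) i hi)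

lemma sigmaOf_union {Ω : Type*} {d : ℕ} (x : ℕ → Ω → Fin d → ℝ) (S T : Set ℕ) :
    sigmaOf x (S ∪ T) = sigmaOf x S ⊔ sigmaOf x T := iSup_union

lemma sigmaOf_eq_comap {Ω : Type*} {d : ℕ} (x : ℕ → Ω → Fin d → ℝ) (S : Set ℕ) :
    sigmaOf x S = MeasurableSpace.comap (fun ω (i : S) => x i ω) inferInstance := by
  apply le_antisymm
  · refine sigmaOf_le_of fun i hi => ?_
    exact (measurable_pi_apply (X := fun _ : S => Fin d → ℝ) (⟨i, hi⟩ : S)).comp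
      (comap_measurable (fun ω (i : S) => x i ω))
  · rw [← measurable_iff_comap_le]
    exact @measurable_pi_lambda _ _ _ (sigmaOf x S) _ _ fun i => measurable_sigmaOf i.2

lemma CondEq.congr_ae {N d : ℕ} {μ : Measure Ω} [IsProbabilityMeasure μ]
    {x x' : ℕ → Ω → Fin d → ℝ} (hx : ∀ i ≤ N, Measurable (x i)) (hx' : ∀ i ≤ N, Measurable (x' i))
    (h : ∀ i ≤ N, x i =ᵐ[μ] x' i) {k : ℕ} (hk : k ≤ N) {S T : Set ℕ}
    (hS : ∀ i ∈ S, i ≤ N) (hT : ∀ i ∈ T, i ≤ N) (hc : CondEq μ x k S T) : CondEq μ x' k S T := by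
  intro A hA
  have key : ∀ U : Set ℕ, (∀ i ∈ U, i ≤ N) →
      μ[A.indicator (fun _ => (1 : ℝ)) ∘ x k | sigmaOf x U] =ᵐ[μ]
        μ[A.indicator (fun _ => (1 : ℝ)) ∘ x' k | sigmaOf x' U] := by
    intro U hU
    have h1 : A.indicator (fun _ => (1 : ℝ)) ∘ x k =ᵐ[μ] A.indicator (fun _ => (1 : ℝ)) ∘ x' k := by
      filter_upwards [h k hk] with ω hω
      simp [Function.comp, hω]
    refine (condExp_congr_ae h1).trans ?_
    rw [sigmaOf_eq_comap, sigmaOf_eq_comap]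
    refine condExp_comap_congr (measurable_pi_lambda _ fun i : U => hx i (hU i i.2))
      (measurable_pi_lambda _ fun i : U => hx' i (hU i i.2)) ?_ (integrable_ind (hx' k hk) hA)
    have : ∀ᵐ ω ∂μ, ∀ i : U, x i ω = x' i ω := ae_all_iff.2 fun i => h i (hU i i.2)
    filter_upwards [this] with ω hω
    exact funext hω
  exact (key S hS).symm.trans ((hc A hA).trans (key T hT))

lemma sigmaOf_shift_le {Ω : Type*} {d c : ℕ} {y z : ℕ → Ω → Fin d → ℝ} {B : ℕ → Mat d}
    (hc : z c = y c) (h : ∀ k, k ≠ c → ∀ ω, z k ω = y k ω + (B k).mulVec (y c ω)) (S : Set ℕ) :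
    sigmaOf z (S ∪ {c}) ≤ sigmaOf y (S ∪ {c}) := by
  refine sigmaOf_le_of fun i hi => ?_
  by_cases hic : i = c
  · rw [hic, hc]; exact measurable_sigmaOf (by simp)
  · have e : z i = fun ω => y i ω + (B i).mulVec (y c ω) := funext (h i hic)
    rw [e]
    have hcont : Continuous (fun v : Fin d → ℝ => (B i).mulVec v) := by fun_prop
    have h1 : Measurable[sigmaOf y (S ∪ {c})] (y i) := measurable_sigmaOf hi
    have h2 : Measurable[sigmaOf y (S ∪ {c})] (y c) := measurable_sigmaOf (by simp)
    exact h1.add (hcont.measurable.comp h2)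

lemma sigmaOf_shift {Ω : Type*} {d c : ℕ} {y z : ℕ → Ω → Fin d → ℝ} {B : ℕ → Mat d}
    (hc : z c = y c) (h : ∀ k, k ≠ c → ∀ ω, z k ω = y k ω + (B k).mulVec (y c ω)) (S : Set ℕ) :
    sigmaOf z (S ∪ {c}) = sigmaOf y (S ∪ {c}) := by
  refine le_antisymm (sigmaOf_shift_le hc h S)
    (sigmaOf_shift_le (B := fun k => - B k) hc.symm (fun k hk ω => ?_) S)
  rw [h k hk, hc, neg_mulVec]; abel

lemma CondEq.shift {N d c : ℕ} (hcN : c ≤ N) {μ : Measure Ω} [IsProbabilityMeasure μ]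
    {y z : ℕ → Ω → Fin d → ℝ} (hy : ∀ i ≤ N, Measurable (y i)) {B : ℕ → Mat d}
    (hc : z c = y c) (h : ∀ k, k ≠ c → ∀ ω, z k ω = y k ω + (B k).mulVec (y c ω))
    {k : ℕ} (hk : k ≤ N) (hkc : k ≠ c) {S T : Set ℕ}
    (hS : ∀ i ∈ S, i ≤ N) (hT : ∀ i ∈ T, i ≤ N)
    (hyC : CondEq μ y k (S ∪ {c}) (T ∪ {c})) : CondEq μ z k (S ∪ {c}) (T ∪ {c}) := by
  intro A hA
  rw [sigmaOf_shift hc h, sigmaOf_shift hc h]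
  have hle : ∀ U : Set ℕ, (∀ i ∈ U, i ≤ N) → sigmaOf y (U ∪ {c}) ≤ ‹MeasurableSpace Ω› := by
    intro U hU
    refine sigmaOf_le_of fun i hi => hy i ?_
    rcases hi with hi | hi
    · exact hU i hi
    · rw [Set.mem_singleton_iff.1 hi]; exact hcN
  let g : (Fin d → ℝ) × (Fin d → ℝ) → (Fin d → ℝ) := fun q => q.1 + (B k).mulVec q.2
  have hg : Measurable g := by
    have : Continuous g := by fun_prop
    exact this.measurable
  have := condExp_pair (hle S hS) (hle T hT) (hy k hk) (measurable_sigmaOf (x := y) (i := c) (by simp))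
    (measurable_sigmaOf (x := y) (i := c) (by simp)) hyC (hg hA)
  have e : A.indicator (fun _ => (1 : ℝ)) ∘ z k =
      (g ⁻¹' A).indicator (fun _ => (1 : ℝ)) ∘ (fun ω => (y k ω, y c ω)) := by
    ext ω
    simp only [Function.comp, h k hkc]
    rfl
  rw [e]
  exact this

lemma condEq_union_iff {N d c : ℕ} (hcN : c ≤ N) {μ : Measure Ω} [IsProbabilityMeasure μ]
    {y : ℕ → Ω → Fin d → ℝ} {C' : Matrix (Fin (N + 1) × Fin d) (Fin (N + 1) × Fin d) ℝ}
    (hy : ZMNG N d μ y C')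
    (hC' : ∀ i j : Fin (N + 1),
      (((i : ℕ) = c ∧ (j : ℕ) ≠ c) ∨ ((i : ℕ) ≠ c ∧ (j : ℕ) = c)) →
      ∀ a b, C' (i, a) (j, b) = 0)
    {k : ℕ} (hk : k ≤ N) (hkc : k ≠ c) {S T : Set ℕ}
    (hS : ∀ i ∈ S, i ≤ N ∧ i ≠ c) (hT : ∀ i ∈ T, i ≤ N ∧ i ≠ c) :
    CondEq μ y k S T ↔ CondEq μ y k (S ∪ {c}) (T ∪ {c}) := by
  obtain ⟨hym, hyG, hyP⟩ := hy
  have hst : Measurable (stack N d y) := measurable_pi_lambda _ fun p =>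
    (measurable_pi_apply p.2).comp (hym p.1 (by have := p.1.2; omega))
  let p : Fin (N + 1) × Fin d → Prop := fun q => (q.1 : ℕ) ≠ c
  have hind := indepFun_of_gaussian hst hyG hyP.posSemidef p
    (fun i j hi hj => hC' i.1 j.1 (Or.inr ⟨hi, not_not.1 hj⟩) i.2 j.2)
    (fun i j hi hj => hC' i.1 j.1 (Or.inl ⟨not_not.1 hi, hj⟩) i.2 j.2)
  rw [IndepFun_iff_Indep] at hind
  have hm1 : MeasurableSpace.comap (fun ω (i : {i // p i}) => stack N d y ω i) inferInstance
      ≤ ‹MeasurableSpace Ω› := Measurable.comap_le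
    (measurable_pi_lambda _ fun i => (measurable_pi_apply (i : Fin (N + 1) × Fin d)).comp hst)
  have hU : ∀ i, i ≤ N → i ≠ c →
      Measurable[MeasurableSpace.comap (fun ω (i : {i // p i}) => stack N d y ω i) inferInstance]
        (y i) := by
    intro i hi hic
    refine @measurable_pi_lambda _ _ _ (_) _ _ fun a => ?_
    exact (measurable_pi_apply (X := fun _ : {i // p i} => ℝ)
      (⟨(⟨i, by omega⟩, a), hic⟩ : {i // p i})).comp
      (comap_measurable (fun ω (i : {i // p i}) => stack N d y ω i))
  have hV : sigmaOf y {c} ≤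
      MeasurableSpace.comap (fun ω (i : {i // ¬ p i}) => stack N d y ω i) inferInstance := by
    refine sigmaOf_le_of fun i hi => ?_
    have hi : i = c := hi
    subst hi
    refine @measurable_pi_lambda _ _ _ (_) _ _ fun a => ?_
    exact (measurable_pi_apply (X := fun _ : {i // ¬ p i} => ℝ)
      (⟨(⟨i, by omega⟩, a), by simp [p]⟩ : {i // ¬ p i})).comp
      (comap_measurable (fun ω (i : {i // ¬ p i}) => stack N d y ω i))
  have hind' := indep_of_indep_of_le_right hind hV
  have hm3 : sigmaOf y {c} ≤ ‹MeasurableSpace Ω› := sigmaOf_le_of fun i hi => by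
    rw [Set.mem_singleton_iff.1 hi]; exact hym c hcN
  have key : ∀ (U : Set ℕ), (∀ i ∈ U, i ≤ N ∧ i ≠ c) → ∀ A : Set (Fin d → ℝ), MeasurableSet A →
      μ[A.indicator (fun _ => (1 : ℝ)) ∘ y k | sigmaOf y U] =ᵐ[μ]
        μ[A.indicator (fun _ => (1 : ℝ)) ∘ y k | sigmaOf y (U ∪ {c})] := by
    intro U hUU A hA
    rw [sigmaOf_union]
    refine condExp_sup_of_indep hm1 hm3
      (sigmaOf_le_of fun i hi => hU i (hUU i hi).1 (hUU i hi).2) hind' ?_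
      (integrable_ind (hym k hk) hA)
    exact ((measurable_const.indicator hA).comp (hU k hk hkc)).stronglyMeasurable
  constructor
  · intro h A hA
    exact (key S hS A hA).symm.trans ((h A hA).trans (key T hT A hA))
  · intro h A hA
    exact (key S hS A hA).trans ((h A hA).trans (key T hT A hA).symm)

/-- For `c ∈ {0, N}`, `CM_c` reduces to the non-trivial index pairs. -/
lemma isCM_iff {N d c : ℕ} (hN : 3 ≤ N) (hc : c = 0 ∨ c = N) {μ : Measure Ω}
    [IsProbabilityMeasure μ]
    {x : ℕ → Ω → Fin d → ℝ} (hx : ∀ i ≤ N, Measurable (x i)) :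
    IsCM μ x 0 N c ↔ ∀ j k, (if c = 0 then 1 else 0) ≤ j → j < k →
      k ≤ (if c = 0 then N else N - 1) →
      CondEq μ x k (Set.Icc (if c = 0 then 1 else 0) j ∪ {c}) ({j} ∪ {c}) := by
  rcases hc with rfl | rfl
  · simp only [if_true]
    have e : ∀ j, Set.Icc 0 j ∪ {0} = Set.Icc 1 j ∪ {0} := by
      intro j; ext i; simp; omega
    constructor
    · intro h j k hj hjk hk
      rw [← e]
      exact h j k (by omega) hjk hk
    · intro h j k hj hjk hk
      by_cases hj0 : j = 0
      · subst hj0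
        intro A hA
        simp
      · rw [e]
        exact h j k (by omega) hjk hk
  · have hc0 : c ≠ 0 := by omega
    simp only [hc0, if_false]
    constructor
    · intro h j k hj hjk hk
      exact h j k hj hjk (by omega)
    · intro h j k hj hjk hk
      by_cases hkc : k = c
      · subst hkc
        intro A hA
        have key : ∀ U : Set ℕ, (∀ i ∈ U, i ≤ k) →
            μ[A.indicator (fun _ => (1 : ℝ)) ∘ x k | sigmaOf x (U ∪ {k})] =
              A.indicator (fun _ => (1 : ℝ)) ∘ x k := by
          intro U hU
          have hle : sigmaOf x (U ∪ {k}) ≤ ‹MeasurableSpace Ω› := sigmaOf_le_of fun i hi => hx i (by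
            rcases hi with hi | hi
            · exact hU i hi
            · exact le_of_eq hi)
          refine condExp_of_stronglyMeasurable hle ?_ (integrable_ind (hx k le_rfl) hA)
          have hm : Measurable[sigmaOf x (U ∪ {k})] (x k) := measurable_sigmaOf (by simp)
          exact ((measurable_const.indicator hA).comp hm).stronglyMeasurable
        rw [key _ (fun i hi => by have := hi.2; omega),
          key _ (fun i hi => by have : i = j := hi; omega)]
      · exact h j k hj hjk (by omega)

end AuxSeq

/-- For `c ∈ {0,N}`: a zero-mean nonsingular Gaussian sequence
`[x_k]`, `k ∈ [0,N]`, is CM_c iff it can be represented as `x_k = y_k + Γ_k x_c`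
for `k ∈ [0,N] \ {c}`, where `[y_k]` is a zero-mean nonsingular Gaussian Markov
sequence on `[0,N] \ {c}`, uncorrelated with the zero-mean nonsingular Gaussian
vector `x_c`, and the `Γ_k` are `d × d` matrices. -/
theorem stmt14 {N d : ℕ} (hN : 3 ≤ N) (hd : 1 ≤ d)
    (μ : Measure Ω) [IsProbabilityMeasure μ] (x : ℕ → Ω → Fin d → ℝ)
    (C : Matrix (Fin (N + 1) × Fin d) (Fin (N + 1) × Fin d) ℝ)
    (hx : ZMNG N d μ x C) (c : ℕ) (hc : c = 0 ∨ c = N) :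
    IsCM μ x 0 N c ↔
      ∃ (y : ℕ → Ω → Fin d → ℝ) (Γ : ℕ → Mat d),
        MarkovPlusVector N d c μ x y Γ := by
  have hcN : c ≤ N := by omega
  rw [isCM_iff hN hc hx.1]
  constructor
  · intro h
    obtain ⟨Γ, C', hy, hC'⟩ := exists_decor hcN hx
    refine ⟨_, Γ, C', ?_, hy, hC', ?_, ?_⟩
    · simp
    · intro j k hj hjk hk
      have hlt : j ≤ N ∧ k ≤ N ∧ k ≠ c ∧ ∀ i ∈ Set.Icc (if c = 0 then 1 else 0) j, i ≤ N ∧ i ≠ c := by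
        refine ⟨?_, ?_, ?_, ?_⟩
        · split_ifs at hk <;> omega
        · split_ifs at hk <;> omega
        · split_ifs at hk hj <;> omega
        · rintro i ⟨h1, h2⟩
          split_ifs at hk h1 <;> omega
      obtain ⟨hjN, hkN, hkc, hS⟩ := hlt
      have hT : ∀ i ∈ ({j} : Set ℕ), i ≤ N ∧ i ≠ c := by
        intro i hi
        rw [Set.mem_singleton_iff.1 hi]
        exact hS j ⟨hj, le_rfl⟩
      rw [condEq_union_iff hcN hy hC' hkN hkc hS hT]
      refine CondEq.shift (B := fun k => - Γ k) hcN hx.1 (by simp) ?_ hkN hkc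
        (fun i hi => (hS i hi).1) (fun i hi => (hT i hi).1) (h j k hj hjk hk)
      intro i hi ω
      simp [hi, neg_mulVec, sub_eq_add_neg]
    · refine Filter.Eventually.of_forall fun ω k _ hkc => ?_
      simp [hkc]
  · rintro ⟨y, Γ, C', hyc, hy, hC', hM, hxy⟩ j k hj hjk hk
    have hlt : j ≤ N ∧ k ≤ N ∧ k ≠ c ∧ ∀ i ∈ Set.Icc (if c = 0 then 1 else 0) j, i ≤ N ∧ i ≠ c := by
      refine ⟨?_, ?_, ?_, ?_⟩
      · split_ifs at hk <;> omega
      · split_ifs at hk <;> omega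
      · split_ifs at hk hj <;> omega
      · rintro i ⟨h1, h2⟩
        split_ifs at hk h1 <;> omega
    obtain ⟨hjN, hkN, hkc, hS⟩ := hlt
    have hT : ∀ i ∈ ({j} : Set ℕ), i ≤ N ∧ i ≠ c := by
      intro i hi
      rw [Set.mem_singleton_iff.1 hi]
      exact hS j ⟨hj, le_rfl⟩
    have h1 := (condEq_union_iff hcN hy hC' hkN hkc hS hT).1 (hM j k hj hjk hk)
    let z : ℕ → Ω → Fin d → ℝ := fun i ω => if i = c then y c ω else y i ω + (Γ i).mulVec (y c ω)
    have hzm : ∀ i ≤ N, Measurable (z i) := by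
      intro i hi
      by_cases hic : i = c
      · simpa [z, hic] using hy.1 c hcN
      · simp only [z, hic, if_false]
        have hcont : Continuous (fun v : Fin d → ℝ => (Γ i).mulVec v) := by fun_prop
        exact (hy.1 i hi).add (hcont.measurable.comp (hy.1 c hcN))
    have h2 : CondEq μ z k (Set.Icc (if c = 0 then 1 else 0) j ∪ {c}) ({j} ∪ {c}) :=
      CondEq.shift (B := Γ) hcN hy.1 (by simp [z]) (fun i hi ω => by simp [z, hi]) hkN hkc
        (fun i hi => (hS i hi).1) (fun i hi => (hT i hi).1) h1
    refine CondEq.congr_ae hzm hx.1 ?_ hkN ?_ ?_ h2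
    · intro i hi
      filter_upwards [hyc, hxy] with ω h3 h4
      by_cases hic : i = c
      · simp [z, hic, h3]
      · simp [z, hic, h3, h4 i hi hic]
    · rintro i (hi | hi)
      · exact (hS i hi).1
      · rw [Set.mem_singleton_iff.1 hi]; exact hcN
    · rintro i (hi | hi)
      · exact (hT i hi).1
      · rw [Set.mem_singleton_iff.1 hi]; exact hcN

end CMSeqPaper
end

section
/- For every zero-mean nonsingular Gaussian CM_L sequence [x_k], k ∈ [0,N], the Markov-plus-vector representation is unique: if x_k = y_k + Γ_k x_N = ỹ_k + Γ̃_k x_N for all k ∈ [0,N−1], where [y_k]_0^{N−1} and [ỹ_k]_0^{N−1} are zero-mean nonsingular Gaussian Markov sequences each uncorrelated with x_N, and Γ_k, Γ̃_k are d×d matrices, then Γ_k = Γ̃_k and y_k = ỹ_k almost surely for every k ∈ [0,N−1]. -/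
open MeasureTheory ProbabilityTheory Matrix
open scoped NNReal

namespace CMSeqPaper

variable {Ω : Type*} [MeasurableSpace Ω]

/-- The vector supported on the last block, with entries `δ`. -/
def lastVec (N d : ℕ) (δ : Fin d → ℝ) : Fin (N + 1) × Fin d → ℝ :=
  fun p => if p.1 = Fin.last N then δ p.2 else 0

lemma sum_lastVec (N d : ℕ) (δ : Fin d → ℝ) (f : Fin (N + 1) × Fin d → ℝ) :
    ∑ p, lastVec N d δ p * f p = ∑ b, δ b * f (Fin.last N, b) := by
  rw [Fintype.sum_prod_type, Finset.sum_eq_single (Fin.last N)]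
  · simp [lastVec]
  · intro i _ hi
    simp [lastVec, hi]
  · simp

/-- Law of `y_k(a) + t ⟨δ, y_N⟩` when `y_k` and `y_N` are uncorrelated. -/
lemma law_aux {N d : ℕ} {μ : Measure Ω} {y : ℕ → Ω → Fin d → ℝ}
    {C : Matrix (Fin (N + 1) × Fin d) (Fin (N + 1) × Fin d) ℝ}
    (hy : ZMNG N d μ y C)
    (hc : ∀ i j : Fin (N + 1),
      (((i : ℕ) = N ∧ (j : ℕ) ≠ N) ∨ ((i : ℕ) ≠ N ∧ (j : ℕ) = N)) →
      ∀ a b, C (i, a) (j, b) = 0)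
    (k : Fin (N + 1)) (hk : (k : ℕ) ≠ N) (a : Fin d) (δ : Fin d → ℝ) (t : ℝ) :
    0 ≤ C (k, a) (k, a) + t ^ 2 * (lastVec N d δ ⬝ᵥ C.mulVec (lastVec N d δ)) ∧
    μ.map (fun ω => y k ω a + t * ∑ b, δ b * y N ω b) =
      gaussianReal 0 (C (k, a) (k, a) +
        t ^ 2 * (lastVec N d δ ⬝ᵥ C.mulVec (lastVec N d δ))).toNNReal := by
  classical
  obtain ⟨-, hg, hp⟩ := hy
  set M := lastVec N d δ with hM
  have hCM : C.mulVec M (k, a) = 0 := by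
    have := sum_lastVec N d δ (fun p => C (k, a) p)
    simp only [mulVec, dotProduct]
    rw [Finset.sum_congr rfl (fun p _ => mul_comm _ _), this]
    refine Finset.sum_eq_zero fun b _ => ?_
    rw [hc k (Fin.last N) (Or.inr ⟨hk, by simp⟩) a b, mul_zero]
  have hMC : M ⬝ᵥ C.col (k, a) = 0 := by
    simp only [dotProduct]
    rw [hM, sum_lastVec]
    refine Finset.sum_eq_zero fun b _ => ?_
    rw [Matrix.col_apply, hc (Fin.last N) k (Or.inl ⟨by simp, hk⟩) b a, mul_zero]
  have hq : (Pi.single (k, a) 1 + t • M) ⬝ᵥ C.mulVec (Pi.single (k, a) 1 + t • M) =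
      C (k, a) (k, a) + t ^ 2 * (M ⬝ᵥ C.mulVec M) := by
    rw [mulVec_add, mulVec_smul, mulVec_single_one]
    simp only [add_dotProduct, dotProduct_add, smul_dotProduct, dotProduct_smul,
      single_one_dotProduct, hCM, hMC, smul_eq_mul, Matrix.col_apply]
    ring
  rw [← hq]
  refine ⟨?_, ?_⟩
  · have h0 := hp.posSemidef.dotProduct_mulVec_nonneg (Pi.single (k, a) 1 + t • M)
    rwa [star_trivial] at h0
  · rw [← hg]
    congr 1
    funext ω
    simp only [Pi.add_apply, Pi.smul_apply, smul_eq_mul, add_mul, Finset.sum_add_distrib,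
      mul_assoc]
    rw [← Finset.mul_sum, hM, sum_lastVec]
    simp [stack, Pi.single_apply]

/-- For every zero-mean nonsingular Gaussian CM_L sequence
`[x_k]`, `k ∈ [0,N]`, the Markov-plus-vector representation is unique: if
`x_k = y_k + Γ_k x_N = ỹ_k + Γ̃_k x_N` on `[0,N-1]` with both `(y, Γ)` and
`(ỹ, Γ̃)` Markov-plus-vector representations of `x`, then `Γ_k = Γ̃_k` and
`y_k = ỹ_k` almost surely for every `k ∈ [0,N-1]`. -/
theorem stmt16 {N d : ℕ} (hN : 3 ≤ N) (hd : 1 ≤ d)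
    (μ : Measure Ω) [IsProbabilityMeasure μ] (x : ℕ → Ω → Fin d → ℝ)
    (C : Matrix (Fin (N + 1) × Fin d) (Fin (N + 1) × Fin d) ℝ)
    (hx : ZMNG N d μ x C) (hCML : IsCM μ x 0 N N)
    (y y' : ℕ → Ω → Fin d → ℝ) (Γ Γ' : ℕ → Mat d)
    (h1 : MarkovPlusVector N d N μ x y Γ)
    (h2 : MarkovPlusVector N d N μ x y' Γ') :
    (∀ k, k ≤ N - 1 → Γ k = Γ' k) ∧
    (∀ k, k ≤ N - 1 → ∀ᵐ ω ∂μ, y k ω = y' k ω) := by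
  obtain ⟨C₁, hN₁, hy₁, hc₁, -, hr₁⟩ := h1
  obtain ⟨C₂, hN₂, hy₂, hc₂, -, hr₂⟩ := h2
  have hΓ : ∀ k, k ≤ N - 1 → Γ k = Γ' k := by
    intro k hk
    ext a b
    set δ : Fin d → ℝ := fun b => Γ k a b - Γ' k a b with hδ
    have hkN : k ≠ N := by omega
    have hrel : ∀ᵐ ω ∂μ, y' k ω a = y k ω a + ∑ b, δ b * y N ω b := by
      filter_upwards [hN₁, hN₂, hr₁, hr₂] with ω e1 e2 r1 r2
      have r1 := congrFun (r1 k (by omega) hkN) a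
      have r2 := congrFun (r2 k (by omega) hkN) a
      simp only [Pi.add_apply, mulVec, dotProduct] at r1 r2
      simp only [hδ, sub_mul, Finset.sum_sub_distrib, e1]
      linarith
    have key : ∀ t : ℝ,
        C₂ (⟨k, by omega⟩, a) (⟨k, by omega⟩, a) +
          t ^ 2 * (lastVec N d δ ⬝ᵥ C₂.mulVec (lastVec N d δ)) =
        C₁ (⟨k, by omega⟩, a) (⟨k, by omega⟩, a) +
          (1 + t) ^ 2 * (lastVec N d δ ⬝ᵥ C₁.mulVec (lastVec N d δ)) := by
      intro t
      obtain ⟨p2, l2⟩ := law_aux hy₂ hc₂ ⟨k, by omega⟩ hkN a δ t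
      obtain ⟨p1, l1⟩ := law_aux hy₁ hc₁ ⟨k, by omega⟩ hkN a δ (1 + t)
      have hmap : μ.map (fun ω => y' k ω a + t * ∑ b, δ b * y' N ω b) =
          μ.map (fun ω => y k ω a + (1 + t) * ∑ b, δ b * y N ω b) := by
        apply Measure.map_congr
        filter_upwards [hN₁, hN₂, hrel] with ω e1 e2 e
        simp only [e, e2, e1]
        ring
      rw [l2, l1] at hmap
      have := (gaussianReal_ext_iff.1 hmap).2
      exact (Real.toNNReal_eq_toNNReal_iff p2 p1).1 this
    have k0 := key 0
    have k1 := key (-1)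
    have q1 := hy₁.2.2.posSemidef.dotProduct_mulVec_nonneg (lastVec N d δ)
    have q2 := hy₂.2.2.posSemidef.dotProduct_mulVec_nonneg (lastVec N d δ)
    simp only [star_trivial] at q1 q2
    have hz : lastVec N d δ = 0 := by
      by_contra hne
      have := hy₁.2.2.dotProduct_mulVec_pos hne
      simp only [star_trivial] at this
      linarith
    have := congrFun hz (Fin.last N, b)
    simp only [lastVec, if_true, hδ, Pi.zero_apply] at this
    linarith
  refine ⟨hΓ, fun k hk => ?_⟩
  filter_upwards [hr₁, hr₂] with ω r1 r2
  have r1 := r1 k (by omega) (by omega)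
  have r2 := r2 k (by omega) (by omega)
  rw [hΓ k hk] at r1
  exact add_right_cancel (r1.symm.trans r2)

end CMSeqPaper
end

section
/- A zero-mean nonsingular Gaussian sequence [x_k], k ∈ [0,N], is reciprocal if and only if it can be represented both as x_k = y^L_k + Γ^L_k x_N for k ∈ [0,N−1], where [y^L_k]_0^{N−1} is a zero-mean nonsingular Gaussian Markov sequence uncorrelated with the zero-mean nonsingular Gaussian vector x_N and the Γ^L_k are d×d matrices, and as x_k = y^F_k + Γ^F_k x_0 for k ∈ [1,N], where [y^F_k]_1^N is a zero-mean nonsingular Gaussian Markov sequence uncorrelated with the zero-mean nonsingular Gaussian vector x_0 and the Γ^F_k are d×d matrices. -/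
open MeasureTheory ProbabilityTheory Matrix
open scoped NNReal

namespace CMSeqPaper

variable {Ω : Type*} [MeasurableSpace Ω]

section LinearPart
open scoped RealInnerProductSpace

variable {E : Type*} [NormedAddCommGroup E] [InnerProductSpace ℝ E]

/-- Linear (Gaussian) conditional orthogonality. -/
def CI (U W T : Submodule ℝ E) : Prop :=
  ∀ u ∈ U, ∃ t ∈ T, (∀ s ∈ T, ⟪u - t, s⟫ = 0) ∧ ∀ w ∈ W, ⟪u - t, w⟫ = 0

lemma exists_proj (T : Submodule ℝ E) [FiniteDimensional ℝ T] (u : E) :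
    ∃ t ∈ T, ∀ s ∈ T, ⟪u - t, s⟫ = 0 := by
  refine ⟨T.starProjection u, by simp, fun s hs => ?_⟩
  exact Submodule.starProjection_inner_eq_zero u s hs

lemma proj_unique {T : Submodule ℝ E} {u t t' : E} (ht : t ∈ T) (ht' : t' ∈ T)
    (h : ∀ s ∈ T, ⟪u - t, s⟫ = 0) (h' : ∀ s ∈ T, ⟪u - t', s⟫ = 0) : t = t' := by
  have h1 := h (t - t') (T.sub_mem ht ht')
  have h2 := h' (t - t') (T.sub_mem ht ht')
  have h3 : ⟪t - t', t - t'⟫ = 0 := by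
    have : t - t' = (u - t') - (u - t) := by abel
    rw [this, inner_sub_left, ← this, h1, h2, sub_zero]
  exact sub_eq_zero.1 (inner_self_eq_zero.1 h3)

lemma CI.symm {U W T : Submodule ℝ E} [FiniteDimensional ℝ T] (h : CI U W T) : CI W U T := by
  intro w hw
  obtain ⟨t', ht', h'⟩ := exists_proj T w
  refine ⟨t', ht', h', fun u hu => ?_⟩
  obtain ⟨t, ht, h1, h2⟩ := h u hu
  have e1 := h' t ht
  have e2 := h1 t' ht'
  have e3 := h2 w hw
  have e4 : ⟪w - t', u - t⟫ = 0 := by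
    rw [real_inner_comm, inner_sub_right, e3, e2, sub_zero]
  rw [inner_sub_right, e1, sub_zero] at e4
  exact e4

lemma inner_sup {W W' : Submodule ℝ E} {r : E} (h : ∀ w ∈ W, ⟪r, w⟫ = 0)
    (h' : ∀ w ∈ W', ⟪r, w⟫ = 0) : ∀ w ∈ W ⊔ W', ⟪r, w⟫ = 0 := by
  intro w hw
  obtain ⟨a, ha, b, hb, rfl⟩ := Submodule.mem_sup.1 hw
  rw [inner_add_right, h a ha, h' b hb, add_zero]

lemma CI.mono {U W W' T : Submodule ℝ E} (h : CI U W T) (hw : W' ≤ W) : CI U W' T := by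
  intro u hu
  obtain ⟨t, ht, h1, h2⟩ := h u hu
  exact ⟨t, ht, h1, fun w hw' => h2 w (hw hw')⟩

lemma CI.self {U W T : Submodule ℝ E} [FiniteDimensional ℝ T] (hw : W ≤ T) : CI U W T := by
  intro u _
  obtain ⟨t, ht, h1⟩ := exists_proj T u
  exact ⟨t, ht, h1, fun w hw' => h1 w (hw hw')⟩

lemma CI.sup {U W W' T : Submodule ℝ E} (h : CI U W T) (h' : CI U W' T) : CI U (W ⊔ W') T := by
  intro u hu
  obtain ⟨t, ht, h1, h2⟩ := h u hu
  obtain ⟨t', ht', h1', h2'⟩ := h' u hu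
  obtain rfl := proj_unique ht ht' h1 h1'
  exact ⟨t, ht, h1, inner_sup h2 h2'⟩

lemma CI.weak {U W D T : Submodule ℝ E} (h : CI U (W ⊔ D) T) : CI U W (T ⊔ D) := by
  intro u hu
  obtain ⟨t, ht, h1, h2⟩ := h u hu
  exact ⟨t, Submodule.mem_sup_left ht,
    inner_sup h1 fun w hw => h2 w (Submodule.mem_sup_right hw),
    fun w hw => h2 w (Submodule.mem_sup_left hw)⟩

lemma CI.contract {U W D T : Submodule ℝ E} (h : CI U W (T ⊔ D)) (h' : CI U D T) : CI U W T := by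
  intro u hu
  obtain ⟨t, ht, h1, h2⟩ := h u hu
  obtain ⟨t', ht', h1', h2'⟩ := h' u hu
  obtain rfl := proj_unique ht (Submodule.mem_sup_left ht') h1 (inner_sup h1' h2')
  exact ⟨t, ht', h1', h2⟩

lemma CI.inter {U W D T : Submodule ℝ E} (h : CI U W (T ⊔ D)) (h' : CI U D (T ⊔ W))
    (hi : (T ⊔ D) ⊓ (T ⊔ W) ≤ T) : CI U (W ⊔ D) T := by
  intro u hu
  obtain ⟨t, ht, h1, h2⟩ := h u hu
  obtain ⟨t', ht', h1', h2'⟩ := h' u hu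
  have a1 := inner_sup h1 h2
  have a2 := inner_sup h1' h2'
  have e : T ⊔ W ⊔ D = T ⊔ D ⊔ W := by ac_rfl
  rw [e] at a2
  have m2 : t' ∈ T ⊔ D ⊔ W := by rw [← e]; exact Submodule.mem_sup_left ht'
  obtain rfl := proj_unique (Submodule.mem_sup_left ht) m2 a1 a2
  exact ⟨t, hi ⟨ht, ht'⟩, fun s hs => h1 s (Submodule.mem_sup_left hs), inner_sup h2 h2'⟩

lemma recip_of_cm {N : ℕ} (V : ℕ → Submodule ℝ E) [∀ k, FiniteDimensional ℝ (V k)]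
    (hL : ∀ i j k, i < j → j < k → k < N → CI (V k) (V i) (V j ⊔ V N))
    (hF : ∀ i j k, 1 ≤ i → i < j → j < k → k ≤ N → CI (V k) (V i) (V j ⊔ V 0))
    (hI : ∀ j l, 0 < j → j < l → l < N →
      (V j ⊔ V l ⊔ V N) ⊓ (V j ⊔ V l ⊔ V 0) ≤ V j ⊔ V l)
    (i j k l : ℕ) (hjk : j < k) (hkl : k < l) (hl : l ≤ N) (hi : i ≤ j ∨ l ≤ i ∧ i ≤ N) :
    CI (V k) (V i) (V j ⊔ V l) := by
  have hA : ∀ i, i < j → l < N → CI (V k) (V i) (V j ⊔ V l ⊔ V N) := by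
    intro i hij hlN
    have h1 : CI (V i) (V k ⊔ V l) (V j ⊔ V N) :=
      (hL i j k hij hjk (by omega)).symm.sup (hL i j l hij (by omega) hlN).symm
    have := h1.weak.symm
    rwa [show V j ⊔ V N ⊔ V l = V j ⊔ V l ⊔ V N by ac_rfl] at this
  have hB : ∀ i, l < i → i ≤ N → 0 < j → CI (V k) (V i) (V j ⊔ V l ⊔ V 0) := by
    intro i hli hiN hj
    have h1 : CI (V i) (V k ⊔ V j) (V l ⊔ V 0) :=
      (hF k l i (by omega) hkl hli hiN).sup (hF j l i hj (by omega) hli hiN)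
    have := h1.weak.symm
    rwa [show V l ⊔ V 0 ⊔ V j = V j ⊔ V l ⊔ V 0 by ac_rfl] at this
  have hC : 0 < j → l < N → CI (V k) (V 0 ⊔ V N) (V j ⊔ V l) := fun hj hlN =>
    (hA 0 hj hlN).inter (hB N hlN le_rfl hj) (hI j l hj (by omega) hlN)
  rcases hi with hi | ⟨hi, hiN⟩
  · rcases hi.eq_or_lt with rfl | hi
    · exact CI.self le_sup_left
    rcases hl.eq_or_lt with rfl | hl
    · exact hL i j k hi hjk hkl
    · exact (hA i hi hl).contract ((hC (by omega) hl).mono le_sup_right)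
  · rcases hi.eq_or_lt with rfl | hi
    · exact CI.self le_sup_right
    rcases Nat.eq_zero_or_pos j with rfl | hj
    · rw [sup_comm]
      exact (hF k l i hjk hkl hi hiN).symm
    · exact (hB i hi hiN hj).contract ((hC hj (by omega)).mono le_sup_left)

lemma CI_shift {Vk Vi Vj Vc Yk Yi Yj : Submodule ℝ E}
    (hk : Yk ⊔ Vc = Vk ⊔ Vc) (hi : Yi ⊔ Vc = Vi ⊔ Vc) (hj : Yj ⊔ Vc = Vj ⊔ Vc)
    (ok : ∀ y ∈ Yk, ∀ s ∈ Vc, ⟪y, s⟫ = 0) (oj : ∀ y ∈ Yj, ∀ s ∈ Vc, ⟪y, s⟫ = 0) :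
    CI Yk Yi Yj ↔ CI Vk Vi (Vj ⊔ Vc) := by
  constructor
  · intro h u hu
    have hu' : u ∈ Yk ⊔ Vc := by rw [hk]; exact Submodule.mem_sup_left hu
    obtain ⟨y, hy, s, hs, rfl⟩ := Submodule.mem_sup.1 hu'
    obtain ⟨t, ht, h1, h2⟩ := h y hy
    have h3 : ∀ s ∈ Vc, ⟪y - t, s⟫ = 0 := fun s hs => by
      rw [inner_sub_left, ok y hy s hs, oj t ht s hs, sub_zero]
    refine ⟨t + s, ?_, ?_, ?_⟩
    · rw [← hj]; exact Submodule.add_mem_sup ht hs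
    · rw [← hj, add_sub_add_right_eq_sub]; exact inner_sup h1 h3
    · rw [add_sub_add_right_eq_sub]
      intro w hw
      refine inner_sup h2 h3 w ?_
      rw [hi]; exact Submodule.mem_sup_left hw
  · intro h y hy
    have hy' : y ∈ Vk ⊔ Vc := by rw [← hk]; exact Submodule.mem_sup_left hy
    obtain ⟨u, hu, s, hs, hus⟩ := Submodule.mem_sup.1 hy'
    obtain ⟨t, ht, h1, h2⟩ := h u hu
    have hts : t + s ∈ Yj ⊔ Vc := by
      rw [hj]; exact Submodule.add_mem _ ht (Submodule.mem_sup_right hs)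
    obtain ⟨y', hy1, s', hs', e⟩ := Submodule.mem_sup.1 hts
    have e1 : u - t = y - y' - s' := by
      rw [← hus, sub_sub, e]; abel
    have e2 : ⟪y - y' - s', s'⟫ = 0 := by rw [← e1]; exact h1 s' (Submodule.mem_sup_right hs')
    rw [inner_sub_left, inner_sub_left, ok y hy s' hs', oj y' hy1 s' hs'] at e2
    have e3 : s' = 0 := inner_self_eq_zero (𝕜 := ℝ).1 (by linarith)
    subst e3
    rw [sub_zero] at e1
    rw [e1, ← hj] at h1
    refine ⟨y', hy1, fun s hs => h1 s (Submodule.mem_sup_left hs), ?_⟩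
    intro w hw
    have hw' : w ∈ Vi ⊔ Vc := by rw [← hi]; exact Submodule.mem_sup_left hw
    rw [← e1] at h1 ⊢
    exact inner_sup h2 (fun s hs => h1 s (Submodule.mem_sup_right hs)) w hw'

end LinearPart

section ProbPart
open scoped RealInnerProductSpace

/-- Zero-mean jointly Gaussian sequence (no nonsingularity). -/
structure GSeq (N d : ℕ) (μ : Measure Ω) (z : ℕ → Ω → Fin d → ℝ) : Prop where
  meas : ∀ k, k ≤ N → Measurable (z k)
  gauss : HasGaussianLaw (stack N d z) μ
  mean : ∀ k, k ≤ N → ∀ a, ∫ ω, z k ω a ∂μ = 0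

/-- Linear combinations of the stacked vector. -/
noncomputable def lin (N d : ℕ) (z : ℕ → Ω → Fin d → ℝ) (l : Fin (N + 1) × Fin d → ℝ) (ω : Ω) : ℝ :=
  ∑ p, l p * stack N d z ω p

open Classical in
/-- The coordinate as an element of `L²`. -/
noncomputable def ev {d : ℕ} (μ : Measure Ω) (z : ℕ → Ω → Fin d → ℝ) (k : ℕ) (a : Fin d) :
    Lp ℝ 2 μ :=
  if h : MemLp (fun ω => z k ω a) 2 μ then h.toLp _ else 0

/-- Span of the coordinates at times in `T`. -/
noncomputable def VT {d : ℕ} (μ : Measure Ω) (z : ℕ → Ω → Fin d → ℝ) (T : Set ℕ) :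
    Submodule ℝ (Lp ℝ 2 μ) :=
  Submodule.span ℝ {e | ∃ t ∈ T, ∃ a, ev μ z t a = e}

lemma VT_union {d : ℕ} (μ : Measure Ω) (z : ℕ → Ω → Fin d → ℝ) (S T : Set ℕ) :
    VT μ z (S ∪ T) = VT μ z S ⊔ VT μ z T := by
  unfold VT
  rw [← Submodule.span_union]
  congr 1
  ext e
  simp only [Set.mem_union, Set.mem_setOf_eq, or_and_right, exists_or]

lemma ev_mem {d : ℕ} {μ : Measure Ω} {z : ℕ → Ω → Fin d → ℝ} {T : Set ℕ} {k : ℕ} (hk : k ∈ T)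
    (a : Fin d) : ev μ z k a ∈ VT μ z T :=
  Submodule.subset_span ⟨k, hk, a, rfl⟩

lemma VT_mono {d : ℕ} {μ : Measure Ω} {z : ℕ → Ω → Fin d → ℝ} {S T : Set ℕ} (h : S ⊆ T) :
    VT μ z S ≤ VT μ z T :=
  Submodule.span_mono fun _ ⟨t, ht, a, e⟩ => ⟨t, h ht, a, e⟩

lemma VT_fin {d : ℕ} (μ : Measure Ω) (z : ℕ → Ω → Fin d → ℝ) {T : Set ℕ} (hT : T.Finite) :
    FiniteDimensional ℝ (VT μ z T) := by
  have : {e | ∃ t ∈ T, ∃ a, ev μ z t a = e}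
      = (fun p : ℕ × Fin d => ev μ z p.1 p.2) '' (T ×ˢ Set.univ) := by
    ext e; simp
  unfold VT
  rw [this]
  exact FiniteDimensional.span_of_finite ℝ ((hT.prod Set.finite_univ).image _)

instance VT_fin_singleton {d : ℕ} (μ : Measure Ω) (z : ℕ → Ω → Fin d → ℝ) (k : ℕ) :
    FiniteDimensional ℝ (VT μ z {k}) := VT_fin μ z (Set.finite_singleton k)

lemma CI_span {E : Type*} [NormedAddCommGroup E] [InnerProductSpace ℝ E] {A B : Set E}
    {T : Submodule ℝ E}
    (h : ∀ u ∈ A, ∃ t ∈ T, (∀ s ∈ T, ⟪u - t, s⟫ = 0) ∧ ∀ w ∈ B, ⟪u - t, w⟫ = 0) :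
    CI (Submodule.span ℝ A) (Submodule.span ℝ B) T := by
  have hB : ∀ r : E, (∀ w ∈ B, ⟪r, w⟫ = 0) → ∀ w ∈ Submodule.span ℝ B, ⟪r, w⟫ = 0 := by
    intro r hr w hw
    induction hw using Submodule.span_induction with
    | mem x hx => exact hr x hx
    | zero => simp
    | add x y _ _ hx hy => rw [inner_add_right, hx, hy, add_zero]
    | smul c x _ hx => rw [inner_smul_right, hx, mul_zero]
  intro u hu
  induction hu using Submodule.span_induction with
  | mem x hx =>
    obtain ⟨t, ht, h1, h2⟩ := h x hx
    exact ⟨t, ht, h1, hB _ h2⟩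
  | zero => exact ⟨0, T.zero_mem, by simp, by simp⟩
  | add x y _ _ hx hy =>
    obtain ⟨t, ht, h1, h2⟩ := hx
    obtain ⟨t', ht', h1', h2'⟩ := hy
    refine ⟨t + t', T.add_mem ht ht', fun s hs => ?_, fun s hs => ?_⟩
    · rw [add_sub_add_comm, inner_add_left, h1 s hs, h1' s hs, add_zero]
    · rw [add_sub_add_comm, inner_add_left, h2 s hs, h2' s hs, add_zero]
  | smul c x _ hx =>
    obtain ⟨t, ht, h1, h2⟩ := hx
    refine ⟨c • t, T.smul_mem c ht, fun s hs => ?_, fun s hs => ?_⟩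
    · rw [← smul_sub, real_inner_smul_left, h1 s hs, mul_zero]
    · rw [← smul_sub, real_inner_smul_left, h2 s hs, mul_zero]

variable {N d : ℕ} {μ : Measure Ω} {z : ℕ → Ω → Fin d → ℝ}

lemma lin_single (k : ℕ) (hk : k ≤ N) (a : Fin d) (ω : Ω) :
    lin N d z (Pi.single (⟨k, by omega⟩, a) 1) ω = z k ω a := by
  classical
  simp [lin, Pi.single_apply, stack]

lemma lin_add (l m : Fin (N + 1) × Fin d → ℝ) (ω : Ω) :
    lin N d z (l + m) ω = lin N d z l ω + lin N d z m ω := by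
  simp [lin, add_mul, Finset.sum_add_distrib]

lemma lin_sub (l m : Fin (N + 1) × Fin d → ℝ) (ω : Ω) :
    lin N d z (l - m) ω = lin N d z l ω - lin N d z m ω := by
  simp [lin, sub_mul, Finset.sum_sub_distrib]

lemma lin_smul (c : ℝ) (l : Fin (N + 1) × Fin d → ℝ) (ω : Ω) :
    lin N d z (c • l) ω = c * lin N d z l ω := by
  simp [lin, mul_assoc, Finset.mul_sum]

lemma GSeq.memLp (h : GSeq N d μ z) (k : ℕ) (hk : k ≤ N) (a : Fin d) :
    MemLp (fun ω => z k ω a) 2 μ :=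
  (h.gauss.eval (X := fun p ω => stack N d z ω p) (⟨k, by omega⟩, a)).memLp_two

lemma GSeq.memLp_lin (h : GSeq N d μ z) (l : Fin (N + 1) × Fin d → ℝ) :
    MemLp (lin N d z l) 2 μ :=
  memLp_finsetSum _ fun p _ =>
    (h.memLp p.1 (by omega) p.2).const_mul _

lemma GSeq.meas_lin (h : GSeq N d μ z) (l : Fin (N + 1) × Fin d → ℝ) :
    Measurable (lin N d z l) :=
  Finset.measurable_fun_sum _ fun p _ =>
    ((measurable_pi_apply p.2).comp (h.meas p.1 (by omega))).const_mul _

lemma GSeq.mean_lin [IsProbabilityMeasure μ] (h : GSeq N d μ z) (l : Fin (N + 1) × Fin d → ℝ) :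
    ∫ ω, lin N d z l ω ∂μ = 0 := by
  unfold lin
  rw [integral_finsetSum]
  · refine Finset.sum_eq_zero fun p _ => ?_
    rw [integral_const_mul]
    have := h.mean p.1 (by omega) p.2
    simp only [stack]
    rw [this, mul_zero]
  · intro p _
    exact ((h.memLp p.1 (by omega) p.2).integrable (by norm_num)).const_mul _

lemma GSeq.ev_ae (h : GSeq N d μ z) (k : ℕ) (hk : k ≤ N) (a : Fin d) :
    ev μ z k a =ᵐ[μ] fun ω => z k ω a := by
  unfold ev
  rw [dif_pos (h.memLp k hk a)]
  exact MemLp.coeFn_toLp _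

lemma inner_ae {f g : Lp ℝ 2 μ} {f' g' : Ω → ℝ} (hf : f =ᵐ[μ] f') (hg : g =ᵐ[μ] g') :
    ⟪f, g⟫ = ∫ ω, f' ω * g' ω ∂μ := by
  rw [L2.inner_def]
  apply integral_congr_ae
  filter_upwards [hf, hg] with ω h1 h2
  rw [h1, h2]
  simp [mul_comm]

lemma meas_sigma {T : Set ℕ} {t : ℕ} (ht : t ∈ T) (a : Fin d) :
    Measurable[sigmaOf z T] fun ω => z t ω a := by
  have h1 : MeasurableSpace.comap (z t) inferInstance ≤ sigmaOf z T :=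
    le_iSup₂_of_le t ht le_rfl
  have h2 : Measurable[sigmaOf z T] (z t) := (comap_measurable (z t)).mono h1 le_rfl
  exact (measurable_pi_apply a).comp h2

lemma GSeq.sigma_le (h : GSeq N d μ z) {T : Set ℕ} (hT : T ⊆ Set.Iic N) :
    sigmaOf z T ≤ (inferInstance : MeasurableSpace Ω) :=
  iSup₂_le fun i hi => (h.meas i (hT hi)).comap_le

lemma GSeq.repr (h : GSeq N d μ z) {T : Set ℕ} (hT : T ⊆ Set.Iic N) {w : Lp ℝ 2 μ}
    (hw : w ∈ VT μ z T) : ∃ l : Fin (N + 1) × Fin d → ℝ,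
      w =ᵐ[μ] lin N d z l ∧ Measurable[sigmaOf z T] (lin N d z l) := by
  induction hw using Submodule.span_induction with
  | mem x hx =>
    obtain ⟨t, ht, a, rfl⟩ := hx
    refine ⟨Pi.single (⟨t, by have := hT ht; simp at this; omega⟩, a) 1, ?_, ?_⟩
    · filter_upwards [h.ev_ae t (hT ht) a] with ω hω
      rw [lin_single t (hT ht), hω]
    · have : lin N d z (Pi.single (⟨t, by have := hT ht; simp at this; omega⟩, a) 1)
        = fun ω => z t ω a := funext fun ω => lin_single t (hT ht) a ω
      rw [this]
      exact meas_sigma ht a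
  | zero =>
    have : lin N d z 0 = fun _ => 0 := by ext; simp [lin]
    refine ⟨0, ?_, ?_⟩
    · rw [this]; exact Lp.coeFn_zero ℝ 2 μ
    · rw [this]; exact measurable_const
  | add x y _ _ hx hy =>
    obtain ⟨l, h1, h2⟩ := hx
    obtain ⟨l', h1', h2'⟩ := hy
    refine ⟨l + l', ?_, ?_⟩
    · filter_upwards [Lp.coeFn_add x y, h1, h1'] with ω e1 e2 e3
      rw [e1, Pi.add_apply, e2, e3, lin_add]
    · have : lin N d z (l + l') = fun ω => lin N d z l ω + lin N d z l' ω :=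
        funext (lin_add l l')
      rw [this]
      exact h2.add h2'
  | smul c x _ hx =>
    obtain ⟨l, h1, h2⟩ := hx
    refine ⟨c • l, ?_, ?_⟩
    · filter_upwards [Lp.coeFn_smul c x, h1] with ω e1 e2
      rw [e1, Pi.smul_apply, e2, lin_smul, smul_eq_mul]
    · have : lin N d z (c • l) = fun ω => c * lin N d z l ω := funext (lin_smul c l)
      rw [this]
      exact h2.const_mul c

lemma GSeq.indep [IsProbabilityMeasure μ] (h : GSeq N d μ z) {S : Set ℕ} (hS : S ⊆ Set.Iic N)
    (L : Fin d → Fin (N + 1) × Fin d → ℝ)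
    (ho : ∀ a, ∀ i ∈ S, ∀ b, ∫ ω, lin N d z (L a) ω * z i ω b ∂μ = 0) :
    Indep (MeasurableSpace.comap (fun ω a => lin N d z (L a) ω) inferInstance) (sigmaOf z S) μ := by
  classical
  let Z : Fin (N + 1) × Fin d → Ω → ℝ := fun p ω => if (p.1 : ℕ) ∈ S then stack N d z ω p else 0
  have hG : HasGaussianLaw (fun ω => (fun a => lin N d z (L a) ω, fun p => Z p ω)) μ := by
    let A : ((Fin (N + 1) × Fin d) → ℝ) →ₗ[ℝ] ((Fin d → ℝ) × ((Fin (N + 1) × Fin d) → ℝ)) :=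
      { toFun := fun v => (fun a => ∑ p, L a p * v p, fun p => if (p.1 : ℕ) ∈ S then v p else 0)
        map_add' := by
          intro v w
          ext <;> simp [mul_add, Finset.sum_add_distrib]
          split_ifs <;> simp
        map_smul' := by
          intro c v
          ext <;> simp [Finset.mul_sum, mul_left_comm] }
    exact h.gauss.map_fun (LinearMap.toContinuousLinearMap A)
  have hI : IndepFun (fun ω a => lin N d z (L a) ω) (fun ω p => Z p ω) μ := by
    refine hG.indepFun_of_covariance_eval (X := fun a ω => lin N d z (L a) ω) (Y := Z) ?_
    intro a p
    by_cases hp : (p.1 : ℕ) ∈ S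
    · have e : Z p = fun ω => z p.1 ω p.2 := by ext ω; simp [Z, hp, stack]
      rw [e, covariance_eq_sub (h.memLp_lin _) (h.memLp _ (by omega) _), h.mean_lin, zero_mul,
        sub_zero]
      exact ho a _ hp _
    · have e : Z p = fun _ => 0 := by ext ω; simp [Z, hp]
      rw [e, covariance_const_right]
  refine indep_of_indep_of_le_right hI ?_
  refine iSup₂_le fun i hi => ?_
  have e : z i = (fun v : Fin (N + 1) × Fin d → ℝ => fun b : Fin d =>
      v (⟨i, by have := hS hi; simp at this; omega⟩, b)) ∘ (fun ω p => Z p ω) := by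
    ext ω b
    simp [Z, hi, stack]
  rw [e, ← MeasurableSpace.comap_comp]
  apply MeasurableSpace.comap_mono
  apply Measurable.comap_le
  fun_prop

end ProbPart

section CondPart
open scoped RealInnerProductSpace

lemma condExp_indep_prod {β γ : Type*} {mβ : MeasurableSpace β} [MeasurableSpace γ]
    [StandardBorelSpace γ] [Nonempty γ] {μ : Measure Ω} [IsProbabilityMeasure μ]
    {X : Ω → β} {Y : Ω → γ} (hX : Measurable X) (hY : Measurable Y) (hXY : IndepFun X Y μ)
    {f : β × γ → ℝ} (hf : StronglyMeasurable f) (hfi : Integrable (fun ω => f (X ω, Y ω)) μ) :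
    μ[fun ω => f (X ω, Y ω) | mβ.comap X] =ᵐ[μ] fun ω => ∫ y, f (X ω, y) ∂(μ.map Y) := by
  have : IsProbabilityMeasure (μ.map Y) := Measure.isProbabilityMeasure_map hY.aemeasurable
  have : IsProbabilityMeasure (μ.map X) := Measure.isProbabilityMeasure_map hX.aemeasurable
  have h1 : condDistrib Y X μ =ᵐ[μ.map X] Kernel.const β (μ.map Y) := by
    apply condDistrib_ae_eq_of_measure_eq_compProd X hY.aemeasurable
    rw [Measure.compProd_const]
    exact (indepFun_iff_map_prod_eq_prod_map_map hX.aemeasurable hY.aemeasurable).1 hXY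
  refine (condExp_prod_ae_eq_integral_condDistrib hX hY.aemeasurable hf hfi).trans ?_
  filter_upwards [ae_of_ae_map hX.aemeasurable h1] with ω hω
  rw [hω, Kernel.const_apply]

lemma condExp_add_indep {Ω : Type*} {d : ℕ} (m : MeasurableSpace Ω) [mΩ : MeasurableSpace Ω]
    {μ : Measure Ω} [IsProbabilityMeasure μ]
    (hm : m ≤ mΩ) {g r : Ω → Fin d → ℝ} (hg : Measurable[m] g)
    (hr : Measurable r) (hi : Indep (MeasurableSpace.comap r inferInstance) m μ)
    {A : Set (Fin d → ℝ)} (hA : MeasurableSet A) :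
    μ[fun ω => A.indicator (fun _ => (1 : ℝ)) (g ω + r ω) | m] =ᵐ[μ]
      fun ω => ∫ y, A.indicator (fun _ => (1 : ℝ)) (g ω + y) ∂(μ.map r) := by
  have hid : @Measurable Ω Ω mΩ m id := measurable_id'' hm
  have hind : @IndepFun Ω Ω (Fin d → ℝ) mΩ m _ id r μ := by
    have : Indep m (MeasurableSpace.comap r inferInstance) μ := hi.symm
    show Indep (MeasurableSpace.comap id m) _ μ
    rw [MeasurableSpace.comap_id]
    exact this
  have hadd : @Measurable (Ω × (Fin d → ℝ)) (Fin d → ℝ) (m.prod inferInstance) _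
      (fun q => g q.1 + q.2) := by
    have a1 : @Measurable (Ω × (Fin d → ℝ)) (Fin d → ℝ) (m.prod inferInstance) _
      (fun q => g q.1) := hg.comp (@measurable_fst _ _ m _)
    have a2 : @Measurable (Ω × (Fin d → ℝ)) (Fin d → ℝ) (m.prod inferInstance) _
      (fun q => q.2) := (@measurable_snd _ _ m _)
    exact a1.add a2
  have hind1 : Measurable (A.indicator (fun _ => (1 : ℝ))) := measurable_const.indicator hA
  have hf : @StronglyMeasurable (Ω × (Fin d → ℝ)) ℝ _ (m.prod inferInstance)
      (fun q => A.indicator (fun _ => (1 : ℝ)) (g q.1 + q.2)) :=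
    (hind1.comp hadd).stronglyMeasurable
  have := @condExp_indep_prod Ω mΩ Ω (Fin d → ℝ) m _ _ _ μ _ id r hid hr hind
    (fun q => A.indicator (fun _ => (1 : ℝ)) (g q.1 + q.2)) hf ?_
  · rw [MeasurableSpace.comap_id] at this
    exact this
  · refine Integrable.of_bound (C := 1) ?_ ?_
    · have : Measurable g := hg.mono hm le_rfl
      exact (hind1.comp (this.add hr)).aestronglyMeasurable
    · filter_upwards with ω
      simp only [id]
      refine (norm_indicator_le_norm_self _ _).trans (by simp)

variable {N d : ℕ} {μ : Measure Ω} {z : ℕ → Ω → Fin d → ℝ}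

lemma sigmaOf_mono {S T : Set ℕ} (h : T ⊆ S) : sigmaOf z T ≤ sigmaOf z S :=
  iSup₂_le fun i hi => le_iSup₂_of_le i (h hi) le_rfl

/-- residual data -/
lemma GSeq.resid (h : GSeq N d μ z) {T : Set ℕ} (hT : T ⊆ Set.Iic N)
    {k : ℕ} (hk : k ≤ N) (a : Fin d) :
    ∃ w ∈ VT μ z T, (∀ s ∈ VT μ z T, ⟪ev μ z k a - w, s⟫ = 0) ∧
      ∃ l : Fin (N + 1) × Fin d → ℝ, w =ᵐ[μ] lin N d z l ∧
        Measurable[sigmaOf z T] (lin N d z l) ∧ ∀ i ≤ N, ∀ b,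
        ∫ ω, lin N d z (Pi.single (⟨k, by omega⟩, a) 1 - l) ω * z i ω b ∂μ =
          ⟪ev μ z k a - w, ev μ z i b⟫ := by
  have := VT_fin μ z ((Set.finite_Iic N).subset hT)
  obtain ⟨w, hw, hw'⟩ := exists_proj (VT μ z T) (ev μ z k a)
  obtain ⟨l, h1, h2⟩ := h.repr hT hw
  refine ⟨w, hw, hw', l, h1, h2, fun i hi b => ?_⟩
  refine (inner_ae ?_ (h.ev_ae i hi b)).symm
  filter_upwards [Lp.coeFn_sub (ev μ z k a) w, h.ev_ae k hk a, h1] with ω e1 e2 e3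
  rw [e1, Pi.sub_apply, e2, e3, lin_sub, lin_single k hk]

lemma GSeq.condEq_of_CI [IsProbabilityMeasure μ] (h : GSeq N d μ z) {S T : Set ℕ}
    (hS : S ⊆ Set.Iic N) (hTS : T ⊆ S) {k : ℕ} (hk : k ≤ N)
    (hc : ∀ i ∈ S, CI (VT μ z {k}) (VT μ z {i}) (VT μ z T)) : CondEq μ z k S T := by
  have hT := hTS.trans hS
  choose w hw hw' l hl hm hint using fun a => h.resid hT hk a
  let L : Fin d → Fin (N + 1) × Fin d → ℝ := fun a => Pi.single (⟨k, by omega⟩, a) 1 - l a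
  have hI := h.indep hS L fun a i hi b => by
    rw [hint a i (hS hi) b]
    obtain ⟨t, ht, h1, h2⟩ := hc i hi (ev μ z k a) (ev_mem (Set.mem_singleton k) a)
    obtain rfl := proj_unique (hw a) ht (hw' a) h1
    exact h2 _ (ev_mem (Set.mem_singleton i) b)
  let g : Ω → Fin d → ℝ := fun ω a => lin N d z (l a) ω
  let r : Ω → Fin d → ℝ := fun ω a => lin N d z (L a) ω
  have hgT : Measurable[sigmaOf z T] g := by
    refine @measurable_pi_lambda _ _ _ (sigmaOf z T) _ _ ?_
    exact hm
  have hgS : Measurable[sigmaOf z S] g := hgT.mono (sigmaOf_mono hTS) le_rfl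
  have hr : Measurable r := measurable_pi_lambda _ fun a => h.meas_lin _
  have hz : ∀ ω, z k ω = g ω + r ω := by
    intro ω; ext a
    simp only [g, r, L, Pi.add_apply, lin_sub, lin_single k hk]
    ring
  intro A hA
  have e : A.indicator (fun _ => (1 : ℝ)) ∘ z k
      = fun ω => A.indicator (fun _ => (1 : ℝ)) (g ω + r ω) := by
    ext ω; rw [Function.comp, hz]
  rw [e]
  exact (condExp_add_indep _ (h.sigma_le hS) hgS hr hI hA).trans
    (condExp_add_indep _ (h.sigma_le hT) hgT hr
      (indep_of_indep_of_le_right hI (sigmaOf_mono hTS)) hA).symm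

lemma condExp_eq_of_indicator {Ω γ : Type*} [MeasurableSpace γ] {m₁ m₂ : MeasurableSpace Ω}
    [mΩ : MeasurableSpace Ω] {μ : Measure Ω} [IsProbabilityMeasure μ]
    (hm₁ : m₁ ≤ mΩ) (hm₂ : m₂ ≤ mΩ) {Y : Ω → γ} (hY : Measurable Y)
    (h : ∀ A : Set γ, MeasurableSet A → μ[A.indicator (fun _ => (1 : ℝ)) ∘ Y | m₁]
      =ᵐ[μ] μ[A.indicator (fun _ => (1 : ℝ)) ∘ Y | m₂]) {f : γ → ℝ}
    (hf : Integrable f (μ.map Y)) : μ[f ∘ Y | m₁] =ᵐ[μ] μ[f ∘ Y | m₂] := by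
  have hmp : MeasurePreserving Y μ (μ.map Y) := ⟨hY, rfl⟩
  have hcomp : ∀ {f : γ → ℝ}, Integrable f (μ.map Y) → Integrable (f ∘ Y) μ := fun hf =>
    hf.comp_measurable hY
  refine Integrable.induction (P := fun f : γ → ℝ => μ[f ∘ Y | m₁] =ᵐ[μ] μ[f ∘ Y | m₂])
    ?_ ?_ ?_ ?_ hf
  · intro c s hs _
    have e : (s.indicator fun _ => c) ∘ Y = c • (s.indicator (fun _ => (1 : ℝ)) ∘ Y) := by
      ext ω
      by_cases hω : Y ω ∈ s <;> simp [hω]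
    beta_reduce
    rw [e]
    refine (condExp_smul c _ _).trans (Filter.EventuallyEq.trans ?_ (condExp_smul c _ _).symm)
    filter_upwards [h s hs] with ω hω
    rw [Pi.smul_apply, Pi.smul_apply, hω]
  · intro f g _ hf hg h1 h2
    show μ[f ∘ Y + g ∘ Y | m₁] =ᵐ[μ] μ[f ∘ Y + g ∘ Y | m₂]
    exact (condExp_add (hcomp hf) (hcomp hg) _).trans
      ((h1.add h2).trans (condExp_add (hcomp hf) (hcomp hg) _).symm)
  · let T := Lp.compMeasurePreserving (E := ℝ) (p := 1) Y hmp
    have hc : Continuous T := (Lp.isometry_compMeasurePreserving hmp).continuous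
    have : {f : Lp ℝ 1 (μ.map Y) | μ[f ∘ Y | m₁] =ᵐ[μ] μ[f ∘ Y | m₂]} =
        {f | condExpL1CLM ℝ hm₁ μ (T f) = condExpL1CLM ℝ hm₂ μ (T f)} := by
      ext f
      have key : ∀ (m : MeasurableSpace Ω) (hm : m ≤ mΩ),
          μ[f ∘ Y | m] =ᵐ[μ] condExpL1CLM ℝ hm μ (T f) := by
        intro m hm
        have h1 := condExp_ae_eq_condExpL1CLM hm (L1.integrable_coeFn (T f))
        rw [Integrable.toL1_coeFn] at h1
        exact (condExp_congr_ae (Lp.coeFn_compMeasurePreserving f hmp).symm).trans h1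
      constructor
      · intro hh
        exact Lp.ext (((key _ hm₁).symm.trans hh).trans (key _ hm₂))
      · intro hh
        have hh' : condExpL1CLM ℝ hm₁ μ (T f) = condExpL1CLM ℝ hm₂ μ (T f) := hh
        have k1 := key _ hm₁
        rw [hh'] at k1
        exact k1.trans (key _ hm₂).symm
    rw [this]
    exact isClosed_eq ((condExpL1CLM ℝ hm₁ μ).continuous.comp hc)
      ((condExpL1CLM ℝ hm₂ μ).continuous.comp hc)
  · intro f g hfg hf h1
    have e : f ∘ Y =ᵐ[μ] g ∘ Y := ae_of_ae_map hY.aemeasurable hfg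
    exact (condExp_congr_ae e).symm.trans (h1.trans (condExp_congr_ae e))

lemma GSeq.CI_of_condEq [IsProbabilityMeasure μ] (h : GSeq N d μ z) {S T : Set ℕ}
    (hS : S ⊆ Set.Iic N) (hTS : T ⊆ S) {k : ℕ} (hk : k ≤ N) (hc : CondEq μ z k S T)
    (i : ℕ) (hi : i ∈ S) : CI (VT μ z {k}) (VT μ z {i}) (VT μ z T) := by
  have hT := hTS.trans hS
  apply CI_span
  rintro u ⟨t, rfl, a, rfl⟩
  choose w hw hw' l hl hm hint using fun a => h.resid hT hk a
  refine ⟨w a, hw a, hw' a, ?_⟩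
  rintro v ⟨i', rfl, b, rfl⟩
  rw [← hint a i' (hS hi) b]
  let L : Fin d → Fin (N + 1) × Fin d → ℝ := fun a => Pi.single (⟨t, by omega⟩, a) 1 - l a
  have hI := h.indep hT L fun a i hi b => by
    rw [hint a i (hT hi) b]
    exact hw' a _ (ev_mem hi b)
  have hr : Measurable fun ω a => lin N d z (L a) ω :=
    measurable_pi_lambda _ fun a => h.meas_lin _
  have hrint : Integrable (lin N d z (L a)) μ := (h.memLp_lin _).integrable (by norm_num)
  have hlint : Integrable (lin N d z (l a)) μ := (h.memLp_lin _).integrable (by norm_num)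
  have hzint : Integrable (fun ω => z t ω a) μ := (h.memLp _ hk _).integrable (by norm_num)
  have c1 : μ[lin N d z (L a) | sigmaOf z T] =ᵐ[μ] fun _ => 0 := by
    have := condExp_indep_eq (f := lin N d z (L a)) hr.comap_le (h.sigma_le hT) ?_ hI
    · rwa [h.mean_lin] at this
    · refine Measurable.stronglyMeasurable ?_
      exact (measurable_pi_apply a).comp (comap_measurable (fun ω a => lin N d z (L a) ω))
  have c2 : μ[fun ω => z t ω a | sigmaOf z S] =ᵐ[μ] μ[fun ω => z t ω a | sigmaOf z T] := by
    refine condExp_eq_of_indicator (h.sigma_le hS) (h.sigma_le hT) (h.meas t hk) hc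
      (f := fun v => v a) ?_
    exact (integrable_map_measure (measurable_pi_apply a).aestronglyMeasurable (h.meas t hk).aemeasurable).2 hzint
  have eL : lin N d z (L a) = (fun ω => z t ω a) - lin N d z (l a) := by
    ext ω; simp only [L, lin_sub, lin_single t hk, Pi.sub_apply]
  have c3 : μ[lin N d z (L a) | sigmaOf z S] =ᵐ[μ] fun _ => 0 := by
    refine Filter.EventuallyEq.trans ?_ c1
    rw [eL]
    refine (condExp_sub hzint hlint _).trans
      (Filter.EventuallyEq.trans ?_ (condExp_sub hzint hlint _).symm)
    rw [condExp_of_stronglyMeasurable (h.sigma_le hT) (hm a).stronglyMeasurable hlint,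
      condExp_of_stronglyMeasurable (h.sigma_le hS)
        ((hm a).mono (sigmaOf_mono hTS) le_rfl).stronglyMeasurable hlint]
    exact c2.sub (Filter.EventuallyEq.refl _ _)
  have hprod : Integrable (lin N d z (L a) * fun ω => z i' ω b) μ :=
    (h.memLp_lin (L a)).integrable_mul (h.memLp i' (hS hi) b)
  have c4 := condExp_mul_of_stronglyMeasurable_right (m := sigmaOf z S)
    (meas_sigma hi b).stronglyMeasurable hprod hrint
  calc ∫ ω, lin N d z (L a) ω * z i' ω b ∂μ
      = ∫ ω, μ[lin N d z (L a) * fun ω => z i' ω b | sigmaOf z S] ω ∂μ :=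
        (integral_condExp (h.sigma_le hS)).symm
    _ = ∫ ω, (0 : ℝ) ∂μ := by
        apply integral_congr_ae
        filter_upwards [c4, c3] with ω e1 e2
        rw [e1, Pi.mul_apply, e2, zero_mul]
    _ = 0 := by simp

end CondPart

section AssemblyPart
open scoped RealInnerProductSpace

variable {N d : ℕ} {μ : Measure Ω} {z : ℕ → Ω → Fin d → ℝ}
  {C : Matrix (Fin (N + 1) × Fin d) (Fin (N + 1) × Fin d) ℝ}

lemma stack_meas (h : ∀ k, k ≤ N → Measurable (z k)) : Measurable (stack N d z) :=
  measurable_pi_lambda _ fun p => (measurable_pi_apply p.2).comp (h p.1 (by omega))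

lemma ZMNG.map_lin (h : ZMNG N d μ z C) (l : Fin (N + 1) × Fin d → ℝ) :
    μ.map (lin N d z l) = gaussianReal 0 (l ⬝ᵥ C.mulVec l).toNNReal := h.2.1 l

lemma ZMNG.gseq (h : ZMNG N d μ z C) : GSeq N d μ z := by
  classical
  refine ⟨h.1, ⟨?_⟩, ?_⟩
  · refine isGaussian_of_map_eq_gaussianReal fun L => ?_
    let l : Fin (N + 1) × Fin d → ℝ := fun p => L (Pi.single p 1)
    refine ⟨0, (l ⬝ᵥ C.mulVec l).toNNReal, ?_⟩
    rw [Measure.map_map L.continuous.measurable (stack_meas h.1), ← h.map_lin l]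
    congr 1
    ext ω
    simp only [Function.comp, lin, l]
    conv_lhs => rw [← Finset.univ_sum_single (stack N d z ω)]
    rw [map_sum]
    refine Finset.sum_congr rfl fun p _ => ?_
    have : Pi.single p (stack N d z ω p)
        = (stack N d z ω p) • (Pi.single p 1 : Fin (N + 1) × Fin d → ℝ) := by
      rw [← Pi.single_smul, smul_eq_mul, mul_one]
    rw [this, map_smul, smul_eq_mul, mul_comm]
  · intro k hk a
    have h1 := h.map_lin (Pi.single (⟨k, by omega⟩, a) 1)
    have e : lin N d z (Pi.single (⟨k, by omega⟩, a) 1) = fun ω => z k ω a :=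
      funext fun ω => lin_single k hk a ω
    rw [e] at h1
    have hm : Measurable fun ω => z k ω a := (measurable_pi_apply a).comp (h.1 k hk)
    have h2 := integral_map (μ := μ) hm.aemeasurable
      (f := fun x : ℝ => x) (by fun_prop)
    rw [← h2, h1, integral_id_gaussianReal]

lemma ZMNG.sq [IsProbabilityMeasure μ] (h : ZMNG N d μ z C) (l : Fin (N + 1) × Fin d → ℝ) :
    ∫ ω, lin N d z l ω * lin N d z l ω ∂μ = l ⬝ᵥ C.mulVec l := by
  have hm := h.gseq.meas_lin l
  have h2 := integral_map (μ := μ) hm.aemeasurable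
      (f := fun x : ℝ => x * x) (by fun_prop)
  rw [← h2, h.map_lin l]
  have h3 := variance_of_integral_eq_zero (X := fun x : ℝ => x)
    (μ := gaussianReal 0 (l ⬝ᵥ C.mulVec l).toNNReal) (by fun_prop) integral_id_gaussianReal
  rw [variance_fun_id_gaussianReal] at h3
  simp only [← pow_two]
  rw [← h3, Real.coe_toNNReal]
  have := h.2.2.posSemidef.dotProduct_mulVec_nonneg l
  simpa using this

lemma ZMNG.bil [IsProbabilityMeasure μ] (h : ZMNG N d μ z C) (l m : Fin (N + 1) × Fin d → ℝ) :
    ∫ ω, lin N d z l ω * lin N d z m ω ∂μ = l ⬝ᵥ C.mulVec m := by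
  have hs := h.sq (l + m)
  have hi : ∀ a b, Integrable (fun ω => lin N d z a ω * lin N d z b ω) μ := fun a b =>
    (h.gseq.memLp_lin a).integrable_mul (h.gseq.memLp_lin b)
  have e : ∀ ω, lin N d z (l + m) ω * lin N d z (l + m) ω =
      (lin N d z l ω * lin N d z l ω + lin N d z m ω * lin N d z m ω)
        + 2 * (lin N d z l ω * lin N d z m ω) := by
    intro ω; rw [lin_add]; ring
  simp only [e] at hs
  have hi2 : Integrable (fun ω => lin N d z l ω * lin N d z l ω + lin N d z m ω * lin N d z m ω) μ :=
    (hi l l).add (hi m m)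
  rw [integral_add hi2 ((hi l m).const_mul 2),
    integral_add (hi l l) (hi m m), integral_const_mul, h.sq, h.sq, mulVec_add, add_dotProduct,
    dotProduct_add, dotProduct_add] at hs
  have hC : Cᵀ = C := by
    have := h.2.2.isHermitian.eq
    rwa [conjTranspose_eq_transpose_of_trivial] at this
  have hsym : m ⬝ᵥ C.mulVec l = l ⬝ᵥ C.mulVec m := by
    rw [dotProduct_comm, dotProduct_mulVec, ← mulVec_transpose, hC, dotProduct_comm] 
  linarith

/-- The stacked family in `L²`. -/
noncomputable def evp (N : ℕ) {d : ℕ} (μ : Measure Ω) (z : ℕ → Ω → Fin d → ℝ)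
    (p : Fin (N + 1) × Fin d) : Lp ℝ 2 μ := ev μ z p.1 p.2

lemma ZMNG.inner_evp [IsProbabilityMeasure μ] (h : ZMNG N d μ z C) (p q : Fin (N + 1) × Fin d) :
    ⟪evp N μ z p, evp N μ z q⟫ = C p q := by
  classical
  unfold evp
  rw [inner_ae (h.gseq.ev_ae _ (by omega) _) (h.gseq.ev_ae _ (by omega) _)]
  have := h.bil (Pi.single p 1) (Pi.single q 1)
  rw [single_one_dotProduct, mulVec_single_one] at this
  simp only [col_apply] at this
  rw [← this]
  congr 1
  ext ω
  rw [lin_single p.1 (by omega) p.2, lin_single q.1 (by omega) q.2]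

lemma ZMNG.linInd [IsProbabilityMeasure μ] (h : ZMNG N d μ z C) :
    LinearIndependent ℝ (evp N μ z) := by
  rw [Fintype.linearIndependent_iff]
  intro l hl
  by_contra hne
  have hl0 : l ≠ 0 := by rintro rfl; simp at hne
  have hp := h.2.2.dotProduct_mulVec_pos hl0
  have h0 : ⟪∑ p, l p • evp N μ z p, ∑ p, l p • evp N μ z p⟫ = (0 : ℝ) := by
    rw [hl, inner_zero_left]
  simp only [sum_inner, inner_sum, real_inner_smul_left, real_inner_smul_right, h.inner_evp] at h0
  have : star l ⬝ᵥ C *ᵥ l = ∑ x, ∑ x_1, l x * (l x_1 * C x_1 x) := by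
    rw [Finset.sum_comm]
    simp only [dotProduct, mulVec, Finset.mul_sum, star_trivial, Pi.star_apply]
    refine Finset.sum_congr rfl fun p _ => Finset.sum_congr rfl fun q _ => by ring
  rw [this] at hp
  linarith

lemma VT_eq {T : Set ℕ} (hT : T ⊆ Set.Iic N) :
    VT μ z T = Submodule.span ℝ (evp N μ z '' {p | (p.1 : ℕ) ∈ T}) := by
  unfold VT
  congr 1
  ext e
  constructor
  · rintro ⟨t, ht, a, rfl⟩
    exact ⟨(⟨t, by have := hT ht; simp at this; omega⟩, a), ht, rfl⟩
  · rintro ⟨p, hp, rfl⟩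
    exact ⟨p.1, hp, p.2, rfl⟩

lemma ZMNG.inf_le [IsProbabilityMeasure μ] (h : ZMNG N d μ z C) {S T : Set ℕ}
    (hS : S ⊆ Set.Iic N) (hT : T ⊆ Set.Iic N) : VT μ z S ⊓ VT μ z T ≤ VT μ z (S ∩ T) := by
  rintro e ⟨h1, h2⟩
  rw [VT_eq hS, SetLike.mem_coe, Finsupp.mem_span_image_iff_linearCombination] at h1
  rw [VT_eq hT, SetLike.mem_coe, Finsupp.mem_span_image_iff_linearCombination] at h2
  rw [VT_eq (Set.inter_subset_left.trans hS), Finsupp.mem_span_image_iff_linearCombination]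
  obtain ⟨l, hl, rfl⟩ := h1
  obtain ⟨l', hl', e⟩ := h2
  obtain rfl : l' = l := h.linInd e
  refine ⟨l', ?_, rfl⟩
  rw [Finsupp.mem_supported] at *
  exact fun p hp => ⟨hl hp, hl' hp⟩

/-- shift relations -/
lemma GSeq.ev_shift {x y : ℕ → Ω → Fin d → ℝ} (hx : GSeq N d μ x) (hy : GSeq N d μ y) {c k : ℕ}
    (hc : c ≤ N) (hk : k ≤ N) {G : Mat d} (h : ∀ᵐ ω ∂μ, x k ω = y k ω + G.mulVec (x c ω))
    (a : Fin d) : ev μ x k a = ev μ y k a + ∑ b, G a b • ev μ x c b := by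
  apply Lp.ext
  have h1 : ∀ᵐ ω ∂μ, ∀ b, ev μ x c b ω = x c ω b := ae_all_iff.2 fun b => hx.ev_ae c hc b
  have h2 : ∀ᵐ ω ∂μ, ∀ b, (G a b • ev μ x c b : Lp ℝ 2 μ) ω = G a b * ev μ x c b ω :=
    ae_all_iff.2 fun b => Lp.coeFn_smul (G a b) (ev μ x c b)
  filter_upwards [h, h1, h2, hx.ev_ae k hk a, hy.ev_ae k hk a,
    Lp.coeFn_add (ev μ y k a) (∑ b, G a b • ev μ x c b),
    Lp.coeFn_finsetSum (p := 2) (μ := μ) Finset.univ (fun b => G a b • ev μ x c b)] with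
    ω e1 e2 e3 e4 e5 e6 e7
  rw [e4, e6, Pi.add_apply, e5, e7, e1]
  simp only [Pi.add_apply, mulVec, dotProduct]
  congr 1
  rw [Finset.sum_apply]
  refine Finset.sum_congr rfl fun b _ => ?_
  rw [e3, e2]

lemma GSeq.shift_sup {x y : ℕ → Ω → Fin d → ℝ} (hx : GSeq N d μ x) (hy : GSeq N d μ y) {c k : ℕ}
    (hc : c ≤ N) (hk : k ≤ N) {G : Mat d} (h : ∀ᵐ ω ∂μ, x k ω = y k ω + G.mulVec (x c ω)) :
    VT μ y {k} ⊔ VT μ x {c} = VT μ x {k} ⊔ VT μ x {c} := by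
  have key := hx.ev_shift hy hc hk h
  have hm : ∀ a, ∑ b, G a b • ev μ x c b ∈ VT μ x {c} := fun a =>
    Submodule.sum_mem _ fun b _ => Submodule.smul_mem _ _ (ev_mem (Set.mem_singleton c) b)
  apply le_antisymm
  · refine sup_le (Submodule.span_le.2 ?_) le_sup_right
    rintro e ⟨t, rfl, a, rfl⟩
    rw [SetLike.mem_coe, eq_sub_of_add_eq (key a).symm]
    exact Submodule.sub_mem _ (Submodule.mem_sup_left (ev_mem (Set.mem_singleton t) a))
      (Submodule.mem_sup_right (hm a))
  · refine sup_le (Submodule.span_le.2 ?_) le_sup_right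
    rintro e ⟨t, rfl, a, rfl⟩
    rw [SetLike.mem_coe, key a]
    exact Submodule.add_mem _ (Submodule.mem_sup_left (ev_mem (Set.mem_singleton t) a))
      (Submodule.mem_sup_right (hm a))

lemma GSeq.ev_congr {x y : ℕ → Ω → Fin d → ℝ} (hx : GSeq N d μ x) (hy : GSeq N d μ y) {c : ℕ}
    (hc : c ≤ N) (h : ∀ᵐ ω ∂μ, y c ω = x c ω) (a : Fin d) : ev μ y c a = ev μ x c a := by
  apply Lp.ext
  filter_upwards [h, hx.ev_ae c hc a, hy.ev_ae c hc a] with ω e1 e2 e3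
  rw [e2, e3, e1]

lemma orth_span {c k : ℕ} {x y : ℕ → Ω → Fin d → ℝ}
    (h : ∀ a b, ⟪ev μ y k a, ev μ x c b⟫ = (0 : ℝ)) :
    ∀ u ∈ VT μ y {k}, ∀ s ∈ VT μ x {c}, ⟪u, s⟫ = (0 : ℝ) := by
  intro u hu s hs
  induction hu using Submodule.span_induction with
  | mem u hu =>
    obtain ⟨t, rfl, a, rfl⟩ := hu
    induction hs using Submodule.span_induction with
    | mem s hs =>
      obtain ⟨t', rfl, b, rfl⟩ := hs
      exact h a b
    | zero => simp
    | add u v _ _ h1 h2 => rw [inner_add_right, h1, h2, add_zero]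
    | smul r u _ h1 => rw [inner_smul_right, h1, mul_zero]
  | zero => simp
  | add u v _ _ h1 h2 => rw [inner_add_left, h1, h2, add_zero]
  | smul r u _ h1 => rw [real_inner_smul_left, h1, mul_zero]

end AssemblyPart

section FinalPart
open scoped RealInnerProductSpace

variable {N d : ℕ} {μ : Measure Ω} {x : ℕ → Ω → Fin d → ℝ}
  {C : Matrix (Fin (N + 1) × Fin d) (Fin (N + 1) × Fin d) ℝ}

lemma exists_gamma (x : ℕ → Ω → Fin d → ℝ) (c k : ℕ) : ∃ G : Mat d, ∀ a b,
    ⟪ev μ x k a - ∑ e, G a e • ev μ x c e, ev μ x c b⟫ = (0 : ℝ) := by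
  have hr : VT μ x {c} = Submodule.span ℝ (Set.range (ev μ x c)) := by
    unfold VT
    congr 1
    ext e
    constructor
    · rintro ⟨t, rfl, a, rfl⟩
      exact ⟨a, rfl⟩
    · rintro ⟨a, rfl⟩
      exact ⟨c, rfl, a, rfl⟩
  choose w hw hw' using fun a => exists_proj (VT μ x {c}) (ev μ x k a)
  have : ∀ a, ∃ g : Fin d → ℝ, ∑ e, g e • ev μ x c e = w a := fun a => by
    have := hw a
    rw [hr, Submodule.mem_span_range_iff_exists_fun] at this
    exact this
  choose G hG using this
  refine ⟨G, fun a b => ?_⟩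
  rw [hG]
  exact hw' a _ (ev_mem (Set.mem_singleton c) b)

/-- the transformation kernel -/
noncomputable def KM (N d c : ℕ) (G : ℕ → Mat d) :
    Matrix (Fin (N + 1) × Fin d) (Fin (N + 1) × Fin d) ℝ :=
  fun p q => if (p.1 : ℕ) ≠ c ∧ (q.1 : ℕ) = c then G p.1 p.2 q.2 else 0

lemma KM_sq (c : ℕ) (G : ℕ → Mat d) : KM N d c G * KM N d c G = 0 := by
  ext p q
  rw [mul_apply, Matrix.zero_apply]
  refine Finset.sum_eq_zero fun r _ => ?_
  by_cases hr : (r.1 : ℕ) = c <;> simp [KM, hr]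

lemma KM_isUnit (c : ℕ) (G : ℕ → Mat d) : IsUnit (1 - KM N d c G) := by
  have h : (1 - KM N d c G) * (1 + KM N d c G) = 1 := by
    have : (1 - KM N d c G) * (1 + KM N d c G) = 1 - KM N d c G * KM N d c G := by noncomm_ring
    rw [this, KM_sq, sub_zero]
  have h' : (1 + KM N d c G) * (1 - KM N d c G) = 1 := by
    have : (1 + KM N d c G) * (1 - KM N d c G) = 1 - KM N d c G * KM N d c G := by noncomm_ring
    rw [this, KM_sq, sub_zero]
  exact ⟨⟨_, _, h, h'⟩, rfl⟩

/-- the shifted sequence -/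
noncomputable def shiftSeq (c : ℕ) (G : ℕ → Mat d) (x : ℕ → Ω → Fin d → ℝ) :
    ℕ → Ω → Fin d → ℝ :=
  fun k ω => if k = c then x k ω else x k ω - (G k).mulVec (x c ω)

lemma stack_shift {c : ℕ} (hc : c ≤ N) (G : ℕ → Mat d) (ω : Ω) :
    stack N d (shiftSeq c G x) ω = (1 - KM N d c G).mulVec (stack N d x ω) := by
  ext p
  rw [sub_mulVec, one_mulVec, Pi.sub_apply]
  have hK : (KM N d c G).mulVec (stack N d x ω) p
      = if (p.1 : ℕ) = c then 0 else (G p.1).mulVec (x c ω) p.2 := by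
    simp only [mulVec, dotProduct]
    rw [Fintype.sum_prod_type]
    rw [Finset.sum_eq_single (⟨c, by omega⟩ : Fin (N + 1))]
    · by_cases hp : (p.1 : ℕ) = c <;> simp [KM, hp, stack]
    · intro b _ hb
      have : (b : ℕ) ≠ c := fun h => hb (Fin.ext h)
      simp [KM, this]
    · simp
  rw [hK]
  simp only [stack, shiftSeq]
  split_ifs <;> simp

lemma ZMNG.shift (hx : ZMNG N d μ x C) {c : ℕ} (hc : c ≤ N) (G : ℕ → Mat d) :
    ZMNG N d μ (shiftSeq c G x) ((1 - KM N d c G) * C * (1 - KM N d c G)ᵀ) := by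
  refine ⟨?_, ?_, ?_⟩
  · intro k hk
    have h1 := hx.1 k hk
    have h2 := hx.1 c hc
    unfold shiftSeq
    by_cases h : k = c
    · simpa [h] using h2
    · simp only [h, if_false]
      refine h1.sub ?_
      have : Measurable (fun v : Fin d → ℝ => (G k).mulVec v) :=
        (Continuous.matrix_mulVec continuous_const continuous_id).measurable
      exact this.comp h2
  · intro l
    have h := hx.2.1 ((1 - KM N d c G)ᵀ *ᵥ l)
    have e1 : ∀ ω, ∑ i, l i * stack N d (shiftSeq c G x) ω i
        = ∑ i, ((1 - KM N d c G)ᵀ *ᵥ l) i * stack N d x ω i := by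
      intro ω
      have : l ⬝ᵥ stack N d (shiftSeq c G x) ω = ((1 - KM N d c G)ᵀ *ᵥ l) ⬝ᵥ stack N d x ω := by
        rw [stack_shift hc, dotProduct_mulVec, mulVec_transpose]
      exact this
    have e2 : l ⬝ᵥ ((1 - KM N d c G) * C * (1 - KM N d c G)ᵀ) *ᵥ l
        = ((1 - KM N d c G)ᵀ *ᵥ l) ⬝ᵥ C *ᵥ ((1 - KM N d c G)ᵀ *ᵥ l) := by
      rw [← mulVec_mulVec, ← mulVec_mulVec, dotProduct_mulVec l, mulVec_transpose _ l]
    simp only [e1]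
    rw [e2]
    exact h
  · have := hx.2.2.mul_mul_conjTranspose_same
      (vecMul_injective_of_isUnit (KM_isUnit (N := N) c G))
    rwa [conjTranspose_eq_transpose_of_trivial] at this

lemma ZMNG.exists_rep [IsProbabilityMeasure μ] (hx : ZMNG N d μ x C) {c : ℕ} (hc : c ≤ N) :
    ∃ (y : ℕ → Ω → Fin d → ℝ) (G : ℕ → Mat d)
      (C' : Matrix (Fin (N + 1) × Fin d) (Fin (N + 1) × Fin d) ℝ),
      ZMNG N d μ y C' ∧ (∀ ω, y c ω = x c ω) ∧
      (∀ ω k, k ≠ c → x k ω = y k ω + (G k).mulVec (x c ω)) ∧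
      ∀ k, k ≤ N → k ≠ c → ∀ a b, ⟪ev μ y k a, ev μ x c b⟫ = (0 : ℝ) := by
  choose G hG using fun k => exists_gamma (μ := μ) x c k
  have hy := hx.shift hc G
  have hsh : ∀ ω k, k ≠ c → x k ω = shiftSeq c G x k ω + (G k).mulVec (x c ω) := by
    intro ω k hk
    simp [shiftSeq, hk]
  refine ⟨shiftSeq c G x, G, _, hy, ?_, hsh, ?_⟩
  · intro ω; simp [shiftSeq]
  · intro k hk hkc a b
    rw [← hG k a b]
    congr 1
    have := hx.gseq.ev_shift hy.gseq hc hk (G := G k) (.of_forall fun ω => hsh ω k hkc) a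
    rw [this, add_sub_cancel_right]

/-- The data shared by both directions. -/
lemma CI_rep {y : ℕ → Ω → Fin d → ℝ} {c : ℕ} {G : ℕ → Mat d} (hx : GSeq N d μ x)
    (hy : GSeq N d μ y) (hc : c ≤ N)
    (hs : ∀ k, k ≤ N → k ≠ c → ∀ᵐ ω ∂μ, x k ω = y k ω + (G k).mulVec (x c ω))
    (ho : ∀ k, k ≤ N → k ≠ c → ∀ a b, ⟪ev μ y k a, ev μ x c b⟫ = (0 : ℝ))
    {i j k : ℕ} (hi : i ≤ N) (hj : j ≤ N) (hk : k ≤ N) (hic : i ≠ c) (hjc : j ≠ c) (hkc : k ≠ c) :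
    CI (VT μ y {k}) (VT μ y {i}) (VT μ y {j}) ↔
      CI (VT μ x {k}) (VT μ x {i}) (VT μ x {j} ⊔ VT μ x {c}) :=
  CI_shift (hx.shift_sup hy hc hk (hs k hk hkc)) (hx.shift_sup hy hc hi (hs i hi hic))
    (hx.shift_sup hy hc hj (hs j hj hjc)) (orth_span (ho k hk hkc)) (orth_span (ho j hj hjc))

lemma mpv_of_CI [IsProbabilityMeasure μ] (hx : ZMNG N d μ x C) {c a b : ℕ} (hc : c ≤ N)
    (ha : a = if c = 0 then 1 else 0) (hb : b = if c = 0 then N else N - 1) (hbN : b ≤ N)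
    (hcab : c < a ∨ b < c)
    (h : ∀ i j k, a ≤ i → i < j → j < k → k ≤ b →
      CI (VT μ x {k}) (VT μ x {i}) (VT μ x {j} ⊔ VT μ x {c})) :
    ∃ (y : ℕ → Ω → Fin d → ℝ) (G : ℕ → Mat d), MarkovPlusVector N d c μ x y G := by
  obtain ⟨y, G, C', hy, hyc, hsh, ho⟩ := hx.exists_rep hc
  refine ⟨y, G, C', .of_forall hyc, hy, ?_, ?_, .of_forall fun ω k _ hk => hsh ω k hk⟩
  · have hev : ∀ b, ev μ y c b = ev μ x c b :=
      hx.gseq.ev_congr hy.gseq hc (.of_forall hyc)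
    rintro i j (⟨h1, h2⟩ | ⟨h1, h2⟩) a b
    · rw [← hy.inner_evp, real_inner_comm]
      unfold evp
      simp only [h1]
      rw [hev]
      exact ho j (by omega) h2 b a
    · rw [← hy.inner_evp]
      unfold evp
      simp only [h2]
      rw [hev]
      exact ho i (by omega) h1 a b
  · rw [← ha, ← hb]
    intro j k hj hjk hk
    refine hy.gseq.condEq_of_CI ?_ ?_ (hk.trans hbN) ?_
    · intro i hi
      have := hi.2
      simp only [Set.mem_Iic]
      omega
    · rintro i rfl
      exact ⟨hj, le_rfl⟩
    · intro i hi
      rcases eq_or_lt_of_le hi.2 with rfl | hij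
      · exact CI.self le_rfl
      · have h1 := hi.1
        exact (CI_rep hx.gseq hy.gseq hc (fun k _ hk => .of_forall fun ω => hsh ω k hk) ho
          (by omega) (by omega) (by omega) (by omega) (by omega) (by omega)).2
          (h i j k h1 hij hjk hk)

lemma CI_of_mpv [IsProbabilityMeasure μ] (hx : ZMNG N d μ x C) {c a b : ℕ} (hc : c ≤ N)
    (ha : a = if c = 0 then 1 else 0) (hb : b = if c = 0 then N else N - 1) (hbN : b ≤ N)
    (hcab : c < a ∨ b < c) {y : ℕ → Ω → Fin d → ℝ} {G : ℕ → Mat d}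
    (h : MarkovPlusVector N d c μ x y G) (i j k : ℕ) (hi : a ≤ i) (hij : i < j) (hjk : j < k)
    (hk : k ≤ b) : CI (VT μ x {k}) (VT μ x {i}) (VT μ x {j} ⊔ VT μ x {c}) := by
  obtain ⟨C', hyc, hy, hz, hM, hsh⟩ := h
  rw [← ha, ← hb] at hM
  have hev : ∀ b, ev μ y c b = ev μ x c b := hx.gseq.ev_congr hy.gseq hc hyc
  have ho : ∀ k, k ≤ N → k ≠ c → ∀ a b, ⟪ev μ y k a, ev μ x c b⟫ = (0 : ℝ) := by
    intro k hk hkc a b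
    rw [← hev]
    have := hy.inner_evp (⟨k, by omega⟩, a) (⟨c, by omega⟩, b)
    rw [hz _ _ (Or.inr ⟨hkc, rfl⟩)] at this
    exact this
  refine (CI_rep hx.gseq hy.gseq hc (fun k hkN hkc => hsh.mono fun ω hω => hω k hkN hkc) ho
    (by omega) (by omega) (by omega) (by omega) (by omega) (by omega)).1 ?_
  refine hy.gseq.CI_of_condEq (S := Set.Icc a j) ?_ ?_ (hk.trans hbN)
    (hM j k (by omega) hjk hk) i ⟨hi, hij.le⟩
  · intro i hi
    have := hi.2
    simp only [Set.mem_Iic]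
    omega
  · rintro i rfl
    exact ⟨by omega, le_rfl⟩

lemma recip_sets {j k l : ℕ} (hjk : j < k) (hkl : k < l) (hl : l ≤ N) :
    Set.Icc 0 j ∪ Set.Icc l N ⊆ Set.Iic N ∧
      ({j} ∪ {l} : Set ℕ) ⊆ Set.Icc 0 j ∪ Set.Icc l N := by
  constructor
  · rintro i (⟨_, hi⟩ | ⟨_, hi⟩) <;> simp only [Set.mem_Iic] <;> omega
  · rintro i (rfl | rfl)
    · exact Or.inl ⟨by omega, le_rfl⟩
    · exact Or.inr ⟨le_rfl, hl⟩

lemma ZMNG.hI [IsProbabilityMeasure μ] (hx : ZMNG N d μ x C) (j l : ℕ) (hj : 0 < j) (hjl : j < l)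
    (hl : l < N) : (VT μ x {j} ⊔ VT μ x {l} ⊔ VT μ x {N}) ⊓
      (VT μ x {j} ⊔ VT μ x {l} ⊔ VT μ x {0}) ≤ VT μ x {j} ⊔ VT μ x {l} := by
  rw [← VT_union, ← VT_union, ← VT_union]
  refine (hx.inf_le ?_ ?_).trans (VT_mono ?_)
  · rintro i ((rfl | rfl) | rfl) <;> simp only [Set.mem_Iic] <;> omega
  · rintro i ((rfl | rfl) | rfl) <;> simp only [Set.mem_Iic] <;> omega
  · rintro i ⟨h1 | h1, h2 | h2⟩
    · exact h1
    · exact h1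
    · exact h2
    · simp only [Set.mem_singleton_iff] at h1 h2
      omega

end FinalPart

/-- A zero-mean nonsingular Gaussian sequence `[x_k]`,
`k ∈ [0,N]`, is reciprocal iff it can be represented both as
`x_k = y^L_k + Γ^L_k x_N`, `k ∈ [0,N-1]` (a Markov-plus-vector representation at
`c = N`), and as `x_k = y^F_k + Γ^F_k x_0`, `k ∈ [1,N]` (a Markov-plus-vector
representation at `c = 0`). -/
theorem stmt17 {N d : ℕ} (hN : 3 ≤ N) (hd : 1 ≤ d)
    (μ : Measure Ω) [IsProbabilityMeasure μ] (x : ℕ → Ω → Fin d → ℝ)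
    (C : Matrix (Fin (N + 1) × Fin d) (Fin (N + 1) × Fin d) ℝ)
    (hx : ZMNG N d μ x C) :
    IsReciprocal μ x N ↔
      ((∃ (yL : ℕ → Ω → Fin d → ℝ) (ΓL : ℕ → Mat d),
          MarkovPlusVector N d N μ x yL ΓL) ∧
       (∃ (yF : ℕ → Ω → Fin d → ℝ) (ΓF : ℕ → Mat d),
          MarkovPlusVector N d 0 μ x yF ΓF)) := by
  have hg := hx.gseq
  constructor
  · intro hr
    have key : ∀ i j k l, j < k → k < l → l ≤ N → i ∈ Set.Icc 0 j ∪ Set.Icc l N →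
        CI (VT μ x {k}) (VT μ x {i}) (VT μ x {j} ⊔ VT μ x {l}) := by
      intro i j k l hjk hkl hl hi
      rw [← VT_union]
      exact hg.CI_of_condEq (recip_sets hjk hkl hl).1 (recip_sets hjk hkl hl).2 (by omega)
        (hr j k l hjk hkl hl) i hi
    constructor
    · refine mpv_of_CI hx (a := 0) (b := N - 1) le_rfl ?_ ?_ (by omega) (by omega) ?_
      · rw [if_neg (by omega)]
      · rw [if_neg (by omega)]
      · intro i j k _ hij hjk hk
        exact key i j k N hjk (by omega) le_rfl (Or.inl ⟨by omega, hij.le⟩)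
    · refine mpv_of_CI hx (a := 1) (b := N) (by omega) ?_ ?_ le_rfl (by omega) ?_
      · rw [if_pos rfl]
      · rw [if_pos rfl]
      · intro i j k hi hij hjk hk
        have := key k 0 i j (by omega) hij (by omega) (Or.inr ⟨hjk.le, hk⟩)
        rw [sup_comm] at this
        exact this.symm
  · rintro ⟨⟨yL, gamL, hL⟩, ⟨yF, gamF, hF⟩⟩ j k l hjk hkl hl
    refine hg.condEq_of_CI (recip_sets hjk hkl hl).1 (recip_sets hjk hkl hl).2 (by omega) ?_
    intro i hi
    rw [VT_union]
    refine recip_of_cm (N := N) (fun k => VT μ x {k}) ?_ ?_ hx.hI i j k l hjk hkl hl ?_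
    · intro i j k hij hjk hk
      exact CI_of_mpv hx (a := 0) (b := N - 1) le_rfl (by rw [if_neg (by omega)])
        (by rw [if_neg (by omega)]) (by omega) (by omega) hL i j k (by omega) hij hjk (by omega)
    · intro i j k hi hij hjk hk
      exact CI_of_mpv hx (a := 1) (b := N) (by omega) (by rw [if_pos rfl])
        (by rw [if_pos rfl]) (by omega) (by omega) hF i j k (by omega) hij hjk (by omega)
    · rcases hi with hi | hi
      · exact Or.inl hi.2
      · exact Or.inr ⟨hi.1, hi.2⟩

end CMSeqPaper
end
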